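/- arXiv:2102.13059 — 6 statements merged into one kernel-verified Lean document; each statement's English description precedes it below -/
import Mathlib

section
/- Let K be a nonempty compact metric space and let 𝒞 be a set of nonempty compact subsets of K that is compact in the Hausdorff metric. Then the set {\overline{dim}_B C : C ∈ 𝒞} is an analytic subset of ℝ. -/
open Filter MeasureTheory Set
open scoped ENNReal

/-- `N_n(s)`: the minimal number of closed balls of radius `2^{-n}` needed to cover `s`. -/
noncomputable def coverNum {X : Type*} [MetricSpace X] (s : Set X) (n : ℕ) : ℕ :=
  sInf {m : ℕ | ∃ t : Finset X, t.card = m ∧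
    s ⊆ ⋃ y ∈ t, Metric.closedBall y ((2 : ℝ) ^ (-(n : ℤ)))}

/-- Upper box dimension: `limsup_n log N_n(s) / (n log 2)`. -/
noncomputable def ubDim {X : Type*} [MetricSpace X] (s : Set X) : ℝ≥0∞ :=
  Filter.limsup
    (fun n : ℕ => ENNReal.ofReal (Real.log (coverNum s n) / (n * Real.log 2)))
    Filter.atTop

theorem coverNum_le_iff9 {K : Type*} [MetricSpace K] [CompactSpace K]
    (C : TopologicalSpace.NonemptyCompacts K) (n m : ℕ) :
    coverNum (C : Set K) n ≤ m ↔ ∃ f : Fin m → K,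
      ∀ x ∈ (C : Set K), ∃ i, dist x (f i) ≤ (2 : ℝ) ^ (-(n : ℤ)) := by
  classical
  constructor
  · intro h
    have hne : {m : ℕ | ∃ t : Finset K, t.card = m ∧
        (C : Set K) ⊆ ⋃ y ∈ t, Metric.closedBall y ((2 : ℝ) ^ (-(n : ℤ)))}.Nonempty := by
      have hr : (0 : ℝ) < (2 : ℝ) ^ (-(n : ℤ)) := by positivity
      obtain ⟨t, -, htf, ht⟩ := C.isCompact.finite_cover_balls hr
      refine ⟨_, htf.toFinset, rfl, ht.trans ?_⟩
      intro x hx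
      simp only [mem_iUnion] at hx ⊢
      obtain ⟨y, hy, hxy⟩ := hx
      exact ⟨y, by simpa using hy, Metric.ball_subset_closedBall hxy⟩
    obtain ⟨t, htc, ht⟩ := Nat.sInf_mem hne
    have htm : t.card ≤ m := by rw [htc]; exact h
    obtain ⟨x0, hx0⟩ := C.nonempty
    refine ⟨fun i => if hi : (i : ℕ) < t.card then (t.equivFin.symm ⟨i, hi⟩ : K) else x0, ?_⟩
    intro x hx
    have := ht hx
    simp only [mem_iUnion] at this
    obtain ⟨y, hy, hxy⟩ := this
    refine ⟨⟨t.equivFin ⟨y, hy⟩, (t.equivFin ⟨y, hy⟩).2.trans_le htm⟩, ?_⟩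
    simpa using hxy
  · rintro ⟨f, hf⟩
    have h1 : coverNum (C : Set K) n ≤ (Finset.univ.image f).card := by
      apply Nat.sInf_le
      refine ⟨_, rfl, ?_⟩
      intro x hx
      obtain ⟨i, hi⟩ := hf x hx
      simp only [mem_iUnion]
      exact ⟨f i, by simp, hi⟩
    exact h1.trans (Finset.card_image_le.trans (by simp))

theorem isClosed_coverNum9 {K : Type*} [MetricSpace K] [CompactSpace K] (n m : ℕ) :
    IsClosed {C : TopologicalSpace.NonemptyCompacts K | coverNum (C : Set K) n ≤ m} := by
  set r : ℝ := (2 : ℝ) ^ (-(n : ℤ)) with hr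
  have hcl : IsClosed {p : TopologicalSpace.NonemptyCompacts K × (Fin m → K) |
      ∀ x ∈ (p.1 : Set K), ∃ i, dist x (p.2 i) ≤ r} := by
    rw [← isOpen_compl_iff, Metric.isOpen_iff]
    rintro ⟨C, f⟩ h
    simp only [mem_compl_iff, mem_setOf_eq, not_forall, not_exists, not_le] at h
    obtain ⟨x, hx, hxf⟩ := h
    have hW : IsOpen {q : K × (Fin m → K) | ∀ i, r < dist q.1 (q.2 i)} := by
      rw [setOf_forall]
      exact isOpen_iInter_of_finite fun i => isOpen_lt (by fun_prop) (by fun_prop)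
    obtain ⟨ε, hε, hb⟩ := Metric.isOpen_iff.1 hW (x, f) hxf
    refine ⟨ε, hε, ?_⟩
    rintro ⟨C', f'⟩ hC'
    rw [Metric.mem_ball, Prod.dist_eq, max_lt_iff] at hC'
    obtain ⟨h1, h2⟩ := hC'
    have h1' : Metric.hausdorffDist (C : Set K) (C' : Set K) < ε := by
      rw [dist_comm] at h1; exact h1
    obtain ⟨x', hx', hxx'⟩ := Metric.exists_dist_lt_of_hausdorffDist_lt hx h1'
      (Metric.hausdorffEDist_ne_top_of_nonempty_of_bounded C.nonempty C'.nonempty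
        C.isCompact.isBounded C'.isCompact.isBounded)
    have := @hb (x', f') (by
      rw [Metric.mem_ball, Prod.dist_eq, max_lt_iff]
      exact ⟨by rw [dist_comm]; exact hxx', h2⟩)
    simp only [mem_compl_iff, mem_setOf_eq, not_forall, not_exists, not_le]
    exact ⟨x', hx', this⟩
  have := isClosedMap_fst_of_compactSpace _ hcl
  convert this using 1
  ext C
  simp [coverNum_le_iff9, hr]

/-- If `K` is a nonempty compact metric space and `𝒞` is a family of nonempty compact
subsets of `K` that is compact in the Hausdorff metric, then the set of upper box
dimensions attained by members of `𝒞` is an analytic subset of `ℝ`. -/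
theorem statement9 (K : Type*) [MetricSpace K] [CompactSpace K] [Nonempty K]
    (𝒞 : Set (TopologicalSpace.NonemptyCompacts K)) (h𝒞 : IsCompact 𝒞) :
    MeasureTheory.AnalyticSet {x : ℝ | ∃ C ∈ 𝒞, (ubDim (C : Set K)).toReal = x} := by
  letI : MeasurableSpace (TopologicalSpace.NonemptyCompacts K) := borel _
  haveI : BorelSpace (TopologicalSpace.NonemptyCompacts K) := ⟨rfl⟩
  have hN : ∀ n, Measurable
      fun C : TopologicalSpace.NonemptyCompacts K => coverNum (C : Set K) n := fun n =>
    measurable_of_Iic fun m => (isClosed_coverNum9 n m).measurableSet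
  have hd : Measurable
      fun C : TopologicalSpace.NonemptyCompacts K => (ubDim (C : Set K)).toReal := by
    apply Measurable.ennreal_toReal
    unfold ubDim
    refine Measurable.limsup fun n => ?_
    have h2 : Measurable fun k : ℕ =>
        ENNReal.ofReal (Real.log (k : ℝ) / (n * Real.log 2)) := measurable_from_top
    exact h2.comp (hN n)
  exact h𝒞.isClosed.measurableSet.analyticSet_image hd
end

section
/- Let K be a nonempty compact metric space and let A ⊆ [0, dim_P K] be an analytic set, where dim_P denotes packing dimension. Then there exists a set 𝒞 of nonempty compact subsets of K that is compact in the Hausdorff metric and satisfies {dim_P C : C ∈ 𝒞} = A. -/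
open Filter MeasureTheory Set
open scoped ENNReal

/-- Packing dimension: the infimum over countable covers of `s` of the supremum of the
upper box dimensions of the pieces. -/
noncomputable def packDim {X : Type*} [MetricSpace X] (s : Set X) : ℝ≥0∞ :=
  ⨅ (E : ℕ → Set X) (_ : s ⊆ ⋃ i, E i), ⨆ i, ubDim (E i)


noncomputable def rd (n : ℕ) : ℝ := (2 : ℝ) ^ (-(n : ℤ))

lemma rd_pos (n : ℕ) : 0 < rd n := by unfold rd; positivity

lemma rd_succ (n : ℕ) : rd (n + 1) = rd n / 2 := by
  unfold rd
  rw [zpow_neg, zpow_neg, zpow_natCast, zpow_natCast, pow_succ]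
  field_simp

lemma rd_anti {m n : ℕ} (h : m ≤ n) : rd n ≤ rd m := by
  unfold rd
  apply zpow_le_zpow_right₀ (by norm_num) (by omega)

lemma rd_zero : rd 0 = 1 := by simp [rd]

lemma rd_lt (ε : ℝ) (hε : 0 < ε) : ∃ k, rd k < ε := by
  obtain ⟨k, hk⟩ := exists_pow_lt_of_lt_one hε (by norm_num : (1/2 : ℝ) < 1)
  refine ⟨k, ?_⟩
  unfold rd
  rw [zpow_neg, zpow_natCast]
  simpa using hk

section cov
set_option linter.unusedSectionVars false
variable {K : Type*} [MetricSpace K]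

lemma coverNum_le {s : Set K} {n : ℕ} (t : Finset K)
    (h : s ⊆ ⋃ y ∈ t, Metric.closedBall y (rd n)) : coverNum s n ≤ t.card :=
  Nat.sInf_le ⟨t, rfl, h⟩

variable [CompactSpace K]

lemma coverNum_spec (s : Set K) (n : ℕ) : ∃ t : Finset K, t.card = coverNum s n ∧
    s ⊆ ⋃ y ∈ t, Metric.closedBall y (rd n) := by
  have : {m : ℕ | ∃ t : Finset K, t.card = m ∧
    s ⊆ ⋃ y ∈ t, Metric.closedBall y ((2 : ℝ) ^ (-(n : ℤ)))}.Nonempty := by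
    obtain ⟨t, htf, ht⟩ := (Metric.totallyBounded_iff.1
      (isCompact_univ (X := K)).totallyBounded) (rd n) (rd_pos n)
    refine ⟨_, htf.toFinset, rfl, ?_⟩
    intro x _
    have := ht (mem_univ x)
    simp only [mem_iUnion] at this ⊢
    obtain ⟨y, hy, hxy⟩ := this
    exact ⟨y, by simpa using hy, Metric.ball_subset_closedBall hxy⟩
  exact Nat.sInf_mem this

lemma coverNum_mono {s t : Set K} (h : s ⊆ t) (n : ℕ) : coverNum s n ≤ coverNum t n := by
  obtain ⟨u, hu, hc⟩ := coverNum_spec t n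
  rw [← hu]
  exact coverNum_le u (h.trans hc)

lemma coverNum_pos {s : Set K} (h : s.Nonempty) (n : ℕ) : 1 ≤ coverNum s n := by
  obtain ⟨u, hu, hc⟩ := coverNum_spec s n
  rw [← hu, Nat.one_le_iff_ne_zero]
  intro h0
  rw [Finset.card_eq_zero] at h0
  subst h0
  obtain ⟨x, hx⟩ := h
  simpa using hc hx

lemma coverNum_closure (s : Set K) (n : ℕ) : coverNum (closure s) n = coverNum s n := by
  apply le_antisymm _ (coverNum_mono subset_closure n)
  obtain ⟨u, hu, hc⟩ := coverNum_spec s n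
  rw [← hu]
  apply coverNum_le
  apply closure_minimal hc
  exact isClosed_biUnion_finset (fun i _ => Metric.isClosed_closedBall)

lemma coverNum_biUnion {ι : Type*} (F : Finset ι) (P : ι → Set K) (n : ℕ) :
    coverNum (⋃ y ∈ F, P y) n ≤ ∑ y ∈ F, coverNum (P y) n := by
  classical
  choose u hu hc using fun y => coverNum_spec (P y) n
  calc _ ≤ (F.biUnion u).card := by
        apply coverNum_le
        intro x hx
        simp only [mem_iUnion, Finset.mem_biUnion] at hx ⊢
        obtain ⟨y, hy, hx⟩ := hx
        have := hc y hx
        simp only [mem_iUnion] at this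
        obtain ⟨z, hz, hxz⟩ := this
        exact ⟨z, ⟨y, hy, hz⟩, hxz⟩
    _ ≤ ∑ y ∈ F, (u y).card := Finset.card_biUnion_le
    _ = _ := by simp [hu]

lemma exists_sep (G : Set K) (n c : ℕ) (hc : c ≤ coverNum G n) :
    ∃ E : Finset K, (E : Set K) ⊆ G ∧ E.card = c ∧
      ∀ z ∈ E, ∀ z' ∈ E, z ≠ z' → rd n < dist z z' := by
  classical
  induction c with
  | zero => exact ⟨∅, by simp, rfl, by simp⟩
  | succ c ih =>
    obtain ⟨E, h1, h2, h3⟩ := ih (by omega)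
    have : ¬ (G ⊆ ⋃ y ∈ E, Metric.closedBall y (rd n)) := by
      intro h
      have := coverNum_le E h
      omega
    obtain ⟨g, hg, hgn⟩ := Set.not_subset.1 this
    simp only [mem_iUnion, Metric.mem_closedBall, not_exists, not_le] at hgn
    have hgE : g ∉ E := fun h => by
      have := hgn g h
      rw [dist_self] at this
      exact absurd this (not_lt.2 (rd_pos n).le)
    refine ⟨insert g E, ?_, ?_, ?_⟩
    · intro x hx
      simp only [Finset.coe_insert, Set.mem_insert_iff] at hx
      rcases hx with rfl | hx
      · exact hg
      · exact h1 hx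
    · rw [Finset.card_insert_of_notMem hgE, h2]
    · intro z hz z' hz' hne
      rw [Finset.mem_insert] at hz hz'
      rcases hz with rfl | hz <;> rcases hz' with rfl | hz'
      · exact absurd rfl hne
      · exact hgn z' hz'
      · rw [dist_comm]; exact hgn z hz
      · exact h3 z hz z' hz' hne

lemma card_le_coverNum (E : Finset K) (n m' : ℕ) (hm : n + 1 ≤ m')
    (hE : ∀ z ∈ E, ∀ z' ∈ E, z ≠ z' → rd n < dist z z') (S : Set K)
    (hS : ∀ z ∈ E, (S ∩ Metric.closedBall z (rd (m' + 1))).Nonempty) :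
    E.card ≤ coverNum S (n + 2) := by
  classical
  obtain ⟨u, hu, hc⟩ := coverNum_spec S (n + 2)
  rw [← hu]
  have key : ∀ z : K, ∃ c, z ∈ E → c ∈ u ∧ dist z c ≤ rd (m' + 1) + rd (n + 2) := by
    intro z
    by_cases hz : z ∈ E
    · obtain ⟨w, hw, hwz⟩ := hS z hz
      have := hc hw
      simp only [mem_iUnion, Metric.mem_closedBall] at this
      obtain ⟨c, hc, hd⟩ := this
      rw [Metric.mem_closedBall] at hwz
      refine ⟨c, fun _ => ⟨hc, ?_⟩⟩
      have := dist_triangle_left z c w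
      linarith
    · exact ⟨z, fun h => absurd h hz⟩
  choose f hf using key
  apply Finset.card_le_card_of_injOn f (fun z hz => (hf z hz).1)
  intro z hz z' hz' h
  by_contra hne
  have h1 := (hf z hz).2
  have h2 := (hf z' hz').2
  rw [← h] at h2
  have h3 := hE z hz z' hz' hne
  have h4 := dist_triangle_right z z' (f z)
  have h5 : rd (m' + 1) ≤ rd (n + 2) := rd_anti (by omega)
  have h6 := rd_succ (n + 1)
  have h7 := rd_succ n
  have : rd (n+2) = rd n / 4 := by rw [show n + 2 = n + 1 + 1 from rfl, h6, h7]; ring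
  linarith

lemma ubDim_mono {s t : Set K} (h : s ⊆ t) : ubDim s ≤ ubDim t := by
  unfold ubDim
  apply Filter.limsup_le_limsup _ (by isBoundedDefault) (by isBoundedDefault)
  apply Filter.Eventually.of_forall
  intro n
  apply ENNReal.ofReal_le_ofReal
  apply div_le_div_of_nonneg_right _ (by positivity)
  rcases Nat.eq_zero_or_pos (coverNum s n) with h0 | h0
  · rw [h0]; simp only [Nat.cast_zero, Real.log_zero]
    exact Real.log_natCast_nonneg _
  · apply Real.log_le_log (by exact_mod_cast h0)
    exact_mod_cast coverNum_mono h n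

lemma ubDim_closure (s : Set K) : ubDim (closure s) = ubDim s := by
  unfold ubDim
  simp only [coverNum_closure]

lemma packDim_le_ubDim (s : Set K) : packDim s ≤ ubDim s := by
  unfold packDim
  refine (iInf₂_le (fun _ => s) (by intro x hx; simpa using hx)).trans ?_
  simp

lemma packDim_mono {s t : Set K} (h : s ⊆ t) : packDim s ≤ packDim t := by
  unfold packDim
  apply le_iInf₂
  intro E hE
  exact iInf₂_le E (h.trans hE)

lemma packDim_iUnion_le (S : ℕ → Set K) (a : ℝ≥0∞) (h : ∀ i, packDim (S i) ≤ a) :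
    packDim (⋃ i, S i) ≤ a := by
  apply le_of_forall_gt
  intro b hb
  obtain ⟨c, hac, hcb⟩ := exists_between hb
  have : ∀ i, ∃ E : ℕ → Set K, S i ⊆ ⋃ j, E j ∧ ∀ j, ubDim (E j) ≤ c := by
    intro i
    have h1 := (h i).trans_lt hac
    unfold packDim at h1
    simp only [iInf_lt_iff] at h1
    obtain ⟨E, hE, hlt⟩ := h1
    exact ⟨E, hE, fun j => (le_iSup (fun j => ubDim (E j)) j).trans hlt.le⟩
  choose E hE hc using this
  refine lt_of_le_of_lt ?_ hcb
  unfold packDim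
  refine (iInf₂_le (fun n => E n.unpair.1 n.unpair.2) ?_).trans (iSup_le fun n => hc _ _)
  intro x hx
  obtain ⟨i, hi⟩ := mem_iUnion.1 hx
  obtain ⟨j, hj⟩ := mem_iUnion.1 (hE i hi)
  refine mem_iUnion.2 ⟨Nat.pair i j, ?_⟩
  simpa using hj

lemma packDim_union_le (S T : Set K) (a : ℝ≥0∞) (h : packDim S ≤ a) (h' : packDim T ≤ a) :
    packDim (S ∪ T) ≤ a := by
  refine (packDim_mono ?_).trans
    (packDim_iUnion_le (fun n : ℕ => if n = 0 then S else T) a ?_)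
  · rintro x (hx | hx)
    · exact mem_iUnion.2 ⟨0, by simpa using hx⟩
    · exact mem_iUnion.2 ⟨1, by simpa using hx⟩
  · intro i
    split_ifs <;> assumption

lemma ubDim_small (s : Set K) (h : ∀ n, coverNum s n ≤ 1) : ubDim s = 0 := by
  unfold ubDim
  have : ∀ n, Real.log (coverNum s n) = 0 := by
    intro n
    have := h n
    interval_cases coverNum s n <;> simp
  simp only [this]
  simp

lemma packDim_singleton (p : K) : packDim ({p} : Set K) = 0 := by
  apply le_antisymm _ zero_le
  refine (packDim_le_ubDim _).trans (ubDim_small _ ?_).le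
  intro n
  apply coverNum_le {p}
  simp [(rd_pos n).le]

lemma packDim_empty : packDim (∅ : Set K) = 0 := by
  apply le_antisymm _ zero_le
  refine (packDim_le_ubDim _).trans (ubDim_small _ ?_).le
  intro n
  refine (coverNum_le ∅ (by simp)).trans (by simp)

/-- Baire category lower bound -/
lemma le_packDim_of_baire (C : Set K) (hC : IsClosed C) (hne : C.Nonempty) (a : ℝ≥0∞)
    (h : ∀ U : Set K, IsOpen U → (C ∩ U).Nonempty → a ≤ ubDim (C ∩ U)) : a ≤ packDim C := by
  unfold packDim
  apply le_iInf₂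
  intro E hE
  have : Nonempty C := hne.to_subtype
  have : CompactSpace C := isCompact_iff_compactSpace.1 hC.isCompact
  obtain ⟨i, hi⟩ := nonempty_interior_of_iUnion_of_closed
    (f := fun i => ((↑) : C → K) ⁻¹' closure (E i))
    (fun i => isClosed_closure.preimage continuous_subtype_val) (by
      rw [← preimage_iUnion, eq_univ_iff_forall]
      rintro ⟨x, hx⟩
      obtain ⟨i, hi⟩ := mem_iUnion.1 (hE hx)
      exact mem_iUnion.2 ⟨i, subset_closure hi⟩)
  obtain ⟨U, hU, hUe⟩ := isOpen_induced_iff.1 (isOpen_interior (s := ((↑) : C → K) ⁻¹' closure (E i)))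
  have hsub : C ∩ U ⊆ closure (E i) := by
    rintro x ⟨hx, hxU⟩
    have : (⟨x, hx⟩ : C) ∈ ((↑) : C → K) ⁻¹' U := hxU
    rw [hUe] at this
    have h2 := interior_subset this
    exact h2
  have hn : (C ∩ U).Nonempty := by
    obtain ⟨x, hx⟩ := hi
    rw [← hUe] at hx
    exact ⟨x, x.2, hx⟩
  calc a ≤ ubDim (C ∩ U) := h U hU hn
    _ ≤ ubDim (closure (E i)) := ubDim_mono hsub
    _ = ubDim (E i) := ubDim_closure _
    _ ≤ _ := le_iSup (fun i => ubDim (E i)) i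

/-- local core -/
lemma exists_point [Nonempty K] : ∃ p : K, ∀ U ∈ nhds p, packDim (univ : Set K) ≤ packDim U := by
  by_contra hcon
  push Not at hcon
  have : packDim (univ : Set K) < packDim (univ : Set K) := by
    refine isCompact_univ.induction_on (p := fun s => packDim s < packDim (univ : Set K)) ?_ ?_ ?_ ?_
    · rw [packDim_empty]
      obtain ⟨U, hU, h⟩ := hcon (Classical.arbitrary K)
      exact lt_of_le_of_lt zero_le h
    · intro s t hst ht
      exact (packDim_mono hst).trans_lt ht
    · intro s t hs ht
      exact (packDim_union_le s t _ (le_max_left _ _) (le_max_right _ _)).trans_lt (max_lt hs ht)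
    · intro x _
      obtain ⟨U, hU, h⟩ := hcon x
      exact ⟨U, mem_nhdsWithin_of_mem_nhds hU, h⟩
  exact lt_irrefl _ this

lemma exists_core (B : Set K) (hB : IsOpen B) (s : ℝ≥0∞) (hs : s < packDim B) :
    ∃ L ⊆ B, L.Nonempty ∧ ∀ U, IsOpen U → (L ∩ U).Nonempty → s ≤ ubDim (L ∩ U) := by
  let b := TopologicalSpace.countableBasis K
  let T : Set (Set K) := {U ∈ b | packDim U ≤ s}
  have hTc : T.Countable := (TopologicalSpace.countable_countableBasis K).mono (fun _ h => h.1)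
  have hW : packDim (⋃₀ T) ≤ s := by
    rcases T.eq_empty_or_nonempty with h | h
    · rw [h, sUnion_empty, packDim_empty]; exact zero_le
    · obtain ⟨f, hf⟩ := hTc.exists_eq_range h
      rw [hf, sUnion_range]
      apply packDim_iUnion_le
      intro i
      have : f i ∈ T := hf ▸ mem_range_self i
      exact this.2
  have aux : ∀ V : Set K, V ⊆ (V \ ⋃₀ T) ∪ ⋃₀ T := fun V => by
    rw [sdiff_union_self]; exact subset_union_left
  refine ⟨B \ ⋃₀ T, sdiff_subset, ?_, ?_⟩
  · by_contra hne
    rw [not_nonempty_iff_eq_empty] at hne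
    have := aux B
    rw [hne, empty_union] at this
    exact absurd ((packDim_mono this).trans hW) (not_le.2 hs)
  · rintro U hU ⟨x, ⟨hxB, hxT⟩, hxU⟩
    by_contra hlt
    rw [not_le] at hlt
    have h1 : packDim (B ∩ U) ≤ s := by
      refine (packDim_mono (aux (B ∩ U))).trans (packDim_union_le _ _ _ ?_ hW)
      refine (packDim_mono ?_).trans ((packDim_le_ubDim _).trans hlt.le)
      rintro y ⟨⟨h1, h2⟩, h3⟩
      exact ⟨⟨h1, h3⟩, h2⟩
    obtain ⟨V, hVb, hxV, hV⟩ := (TopologicalSpace.isBasis_countableBasis K).exists_subset_of_mem_open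
      (show x ∈ B ∩ U from ⟨hxB, hxU⟩) (hB.inter hU)
    exact hxT ⟨V, ⟨hVb, (packDim_mono hV).trans h1⟩, hxV⟩

end cov

section asym
variable {K : Type*} [MetricSpace K] [CompactSpace K]
set_option linter.unusedSectionVars false

lemma le_ubDim_of_freq (E : Set K) (h : ℝ)
    (H : ∀ b < h, ∀ M : ℕ, ∃ n ≥ M, (2 : ℝ) ^ (b * n) ≤ coverNum E (n + 2)) :
    ENNReal.ofReal h ≤ ubDim E := by
  apply le_of_forall_lt
  intro c hc
  have hcf : c ≠ ⊤ := (hc.trans_le le_top).ne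
  obtain ⟨b', hcb', hb'h⟩ := exists_between hc
  refine hcb'.trans_le ?_
  have hb'f : b' ≠ ⊤ := (hb'h.trans_le le_top).ne
  set a := b'.toReal with ha
  have hb'a : b' = ENNReal.ofReal a := (ENNReal.ofReal_toReal hb'f).symm
  have ha0 : 0 ≤ a := ENNReal.toReal_nonneg
  rw [hb'a] at hb'h ⊢
  have hah : a < h := (ENNReal.ofReal_lt_ofReal_iff_of_nonneg ha0).1 hb'h
  obtain ⟨b, hab, hbh⟩ := exists_between hah
  unfold ubDim
  apply Filter.le_limsup_of_frequently_le _ (by isBoundedDefault)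
  rw [Filter.frequently_atTop]
  intro M
  obtain ⟨M', hM'⟩ := exists_nat_ge (2 * a / (b - a))
  obtain ⟨n, hn, hle⟩ := H b hbh (max M M')
  refine ⟨n + 2, by have := le_max_left M M'; omega, ?_⟩
  apply ENNReal.ofReal_le_ofReal
  have hl2 : 0 < Real.log 2 := Real.log_pos (by norm_num)
  rw [le_div_iff₀ (by positivity)]
  have h1 : b * n * Real.log 2 ≤ Real.log (coverNum E (n + 2)) := by
    rw [← Real.log_rpow (by norm_num)]
    exact Real.log_le_log (by positivity) hle
  have h2 : (M' : ℝ) ≤ n := by exact_mod_cast (le_max_right M M').trans hn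
  have h3 : 2 * a ≤ n * (b - a) := by
    rw [← div_le_iff₀ (by linarith)]; linarith
  have h4 : a * ((n + 2 : ℕ) : ℝ) ≤ b * n := by push_cast; nlinarith
  calc _ = a * ((n + 2 : ℕ) : ℝ) * Real.log 2 := by ring
    _ ≤ b * n * Real.log 2 := by gcongr
    _ ≤ _ := h1

lemma ubDim_le_of_event (E : Set K) (h : ℝ) (h0 : 0 ≤ h)
    (H : ∀ a > h, ∃ J : ℕ, ∀ j ≥ J, (coverNum E j : ℝ) ≤ 2 * (2 : ℝ) ^ (a * (j + 1))) :
    ubDim E ≤ ENNReal.ofReal h := by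
  apply le_of_forall_gt
  intro c hc
  obtain ⟨b', hcb', hb'h⟩ := exists_between hc
  refine lt_of_le_of_lt ?_ hb'h
  have hb'f : b' ≠ ⊤ := (hb'h.trans_le le_top).ne
  set b := b'.toReal with hb
  have hb'a : b' = ENNReal.ofReal b := (ENNReal.ofReal_toReal hb'f).symm
  rw [hb'a] at hcb' ⊢
  have hbh : h < b := (ENNReal.ofReal_lt_ofReal_iff_of_nonneg h0).1 hcb'
  obtain ⟨a, hha, hab⟩ := exists_between hbh
  obtain ⟨J, hJ⟩ := H a hha
  obtain ⟨M', hM'⟩ := exists_nat_ge ((a + 1) / (b - a))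
  unfold ubDim
  apply Filter.limsup_le_of_le (by isBoundedDefault)
  filter_upwards [Filter.eventually_ge_atTop (max (max J M') 1)] with j hj
  apply ENNReal.ofReal_le_ofReal
  have hl2 : 0 < Real.log 2 := Real.log_pos (by norm_num)
  have hj1 : 1 ≤ j := (le_max_right _ _).trans hj
  have hj1' : (1 : ℝ) ≤ j := by exact_mod_cast hj1
  have hjJ : J ≤ j := ((le_max_left _ _).trans (le_max_left _ _)).trans hj
  have hjM : M' ≤ j := ((le_max_right _ _).trans (le_max_left _ _)).trans hj
  have h2 : (M' : ℝ) ≤ j := by exact_mod_cast hjM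
  have h3 : a + 1 ≤ j * (b - a) := by
    rw [← div_le_iff₀ (by linarith)]; linarith
  rw [div_le_iff₀ (by positivity)]
  rcases Nat.eq_zero_or_pos (coverNum E j) with hz | hz
  · rw [hz]; simp only [Nat.cast_zero, Real.log_zero]
    have : 0 ≤ b := by linarith
    positivity
  · have h4 : Real.log (coverNum E j) ≤ (1 + a * (j + 1)) * Real.log 2 := by
      rw [← Real.log_rpow (by norm_num), Real.rpow_add (by norm_num), Real.rpow_one]
      exact Real.log_le_log (by exact_mod_cast hz) (hJ j hjJ)
    refine h4.trans ?_
    calc (1 + a * (j + 1)) * Real.log 2 ≤ (b * j) * Real.log 2 := by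
          gcongr
          nlinarith
      _ = _ := by ring

lemma exists_scale (G : Set K) (hG : G.Nonempty) (s t : ℝ) (hts : t < s)
    (hs : ENNReal.ofReal s ≤ ubDim G) (m : ℕ) :
    ∃ n, m + 1 ≤ n ∧ (2 : ℝ) ^ (t * n) ≤ coverNum G n := by
  rcases lt_or_ge t 0 with ht | ht
  · refine ⟨m + 1, le_rfl, ?_⟩
    have h1 : (1 : ℝ) ≤ coverNum G (m + 1) := by exact_mod_cast coverNum_pos hG (m + 1)
    refine le_trans ?_ h1
    apply Real.rpow_le_one_of_one_le_of_nonpos (by norm_num)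
    apply mul_nonpos_of_nonpos_of_nonneg ht.le (by positivity)
  · have h1 : ENNReal.ofReal t < ubDim G :=
      ((ENNReal.ofReal_lt_ofReal_iff_of_nonneg ht).2 hts).trans_le hs
    have h2 := Filter.frequently_lt_of_lt_limsup (by isBoundedDefault) h1
    obtain ⟨n, hn, hlt⟩ := (Filter.frequently_atTop.1 h2) (m + 1)
    refine ⟨n, hn, ?_⟩
    rw [ENNReal.ofReal_lt_ofReal_iff_of_nonneg ht] at hlt
    have hl2 : 0 < Real.log 2 := Real.log_pos (by norm_num)
    have hn1 : (1 : ℝ) ≤ n := by exact_mod_cast (by omega : 1 ≤ n)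
    rw [lt_div_iff₀ (by positivity)] at hlt
    have hp : (0 : ℝ) < coverNum G n := by exact_mod_cast coverNum_pos hG n
    rw [← Real.log_le_log_iff (by positivity) hp, Real.log_rpow (by norm_num)]
    nlinarith

def VV (F : Finset K) (m : ℕ) : Set K := ⋃ y ∈ F, Metric.closedBall y (rd (m + 1))

/-- per-point step -/
lemma step_point (L : Set K) (s : ℝ)
    (hL : ∀ U, IsOpen U → (L ∩ U).Nonempty → ENNReal.ofReal s ≤ ubDim (L ∩ U))
    (y : K) (hy : y ∈ L) (m : ℕ) (ε : ℝ) (hε : 0 < ε) (t : ℝ) (ht0 : 0 ≤ t) (hts : t ≤ s) :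
    ∃ (E : Finset K) (n : ℕ), (E : Set K) ⊆ L ∧ E.Nonempty ∧ m + 1 ≤ n ∧
      (∀ z ∈ E, dist z y ≤ rd (m + 2)) ∧
      (∀ z ∈ E, ∀ z' ∈ E, z ≠ z' → rd n < dist z z') ∧
      (2 : ℝ) ^ ((t - ε) * n) ≤ E.card ∧
      ∀ j m', m ≤ j → j ≤ m' → (coverNum (VV E m') j : ℝ) ≤ 2 * (2 : ℝ) ^ (t * (j + 1)) := by
  classical
  set G := L ∩ Metric.ball y (rd (m + 2)) with hGdef
  have hyG : y ∈ G := ⟨hy, Metric.mem_ball_self (rd_pos _)⟩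
  have hGne : G.Nonempty := ⟨y, hyG⟩
  have hGs : ENNReal.ofReal s ≤ ubDim G := hL _ Metric.isOpen_ball hGne
  have hex := exists_scale G hGne s (t - ε) (by linarith) hGs m
  set n := Nat.find hex with hn
  obtain ⟨hn1, hn2⟩ := Nat.find_spec hex
  have hmin : ∀ i, m + 1 ≤ i → i < n → (coverNum G i : ℝ) < (2 : ℝ) ^ ((t - ε) * i) := by
    intro i hi hin
    have := Nat.find_min hex hin
    push Not at this
    exact this hi
  rw [← hn] at hn1 hn2
  obtain ⟨E, hE1, hE2, hE3⟩ := exists_sep G n ⌈(2 : ℝ) ^ ((t - ε) * n)⌉₊ (Nat.ceil_le.2 hn2)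
  have hcard : (2 : ℝ) ^ ((t - ε) * n) ≤ E.card := by rw [hE2]; exact Nat.le_ceil _
  have hcard2 : (E.card : ℝ) ≤ (2 : ℝ) ^ ((t - ε) * n) + 1 := by
    rw [hE2]; exact (Nat.ceil_lt_add_one (by positivity)).le
  refine ⟨E, n, hE1.trans inter_subset_left, ?_, hn1, ?_, hE3, hcard, ?_⟩
  · rw [← Finset.card_pos]
    have : (0 : ℝ) < E.card := lt_of_lt_of_le (by positivity) hcard
    exact_mod_cast this
  · intro z hz
    exact (Metric.mem_ball.1 (hE1 hz).2).le
  · intro j m' hmj hjm'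
    have hone : (1 : ℝ) ≤ (2 : ℝ) ^ (t * (j + 1)) :=
      Real.one_le_rpow (by norm_num) (by positivity)
    rcases lt_or_ge (j + 1) n with hjn | hjn
    · have h1 := hmin (j + 1) (by omega) hjn
      have h2 : coverNum (VV E m') j ≤ coverNum G (j + 1) := by
        obtain ⟨u, hu, hc⟩ := coverNum_spec G (j + 1)
        rw [← hu]
        apply coverNum_le
        intro x hx
        simp only [VV, mem_iUnion, Metric.mem_closedBall] at hx
        obtain ⟨z, hz, hxz⟩ := hx
        have := hc (hE1 hz)
        simp only [mem_iUnion, Metric.mem_closedBall] at this ⊢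
        obtain ⟨c, hc, hzc⟩ := this
        refine ⟨c, hc, ?_⟩
        have h3 := dist_triangle x z c
        have h4 : rd (m' + 1) ≤ rd (j + 1) := rd_anti (by omega)
        have h5 := rd_succ j
        linarith
      have h3 : (2 : ℝ) ^ ((t - ε) * ((j + 1 : ℕ) : ℝ)) ≤ (2 : ℝ) ^ (t * (j + 1)) := by
        apply Real.rpow_le_rpow_of_exponent_le (by norm_num)
        push_cast
        have : (0 : ℝ) ≤ (j : ℝ) + 1 := by positivity
        nlinarith
      have h4 : (coverNum (VV E m') j : ℝ) ≤ coverNum G (j + 1) := by exact_mod_cast h2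
      linarith
    · have h2 : coverNum (VV E m') j ≤ E.card := by
        apply coverNum_le
        apply iUnion₂_mono
        intro z hz
        exact Metric.closedBall_subset_closedBall (rd_anti (by omega))
      have h4 : (coverNum (VV E m') j : ℝ) ≤ E.card := by exact_mod_cast h2
      have h3 : (2 : ℝ) ^ ((t - ε) * n) ≤ (2 : ℝ) ^ (t * (j + 1)) := by
        apply Real.rpow_le_rpow_of_exponent_le (by norm_num)
        have h5 : (n : ℝ) ≤ j + 1 := by exact_mod_cast hjn
        have h6 : (0 : ℝ) ≤ n := by positivity
        nlinarith
      linarith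

lemma step_all (L : Set K) (s : ℝ)
    (hL : ∀ U, IsOpen U → (L ∩ U).Nonempty → ENNReal.ofReal s ≤ ubDim (L ∩ U))
    (S : {F : Finset K // (F : Set K) ⊆ L ∧ F.Nonempty} × ℕ) (ε : {e : ℝ // 0 < e})
    (t : Icc (0 : ℝ) s) :
    ∃ S' : {F : Finset K // (F : Set K) ⊆ L ∧ F.Nonempty} × ℕ,
      S.2 < S'.2 ∧ (S'.1.1.card : ℝ) ≤ (2 : ℝ) ^ (ε.1 * S'.2) ∧
      (∀ z ∈ S'.1.1, ∃ y ∈ S.1.1, dist z y ≤ rd (S.2 + 2)) ∧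
      (∀ y ∈ S.1.1, ∃ z ∈ S'.1.1, dist z y ≤ rd (S.2 + 2)) ∧
      (∀ j, S.2 ≤ j → j ≤ S'.2 →
        (coverNum (VV S'.1.1 S'.2) j : ℝ) ≤ S.1.1.card * (2 * (2 : ℝ) ^ (t.1 * (j + 1)))) ∧
      (∀ y ∈ S.1.1, ∃ n, S.2 + 1 ≤ n ∧ ∀ T : Set K,
        (∀ z ∈ S'.1.1, dist z y ≤ rd (S.2 + 2) →
          (T ∩ Metric.closedBall z (rd (S'.2 + 1))).Nonempty) →
        (2 : ℝ) ^ ((t.1 - ε.1) * n) ≤ coverNum T (n + 2)) := by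
  classical
  obtain ⟨⟨F, hFL, hFne⟩, m⟩ := S
  obtain ⟨ε, hε⟩ := ε
  obtain ⟨t, ht0, hts⟩ := t
  dsimp only
  choose E n hEL hEne hmn hd hsep hcard hcov using
    fun y : F => step_point L s hL y.1 (hFL y.2) m ε hε t ht0 hts
  set F' := Finset.univ.biUnion E with hF'
  have hmem : ∀ z, z ∈ F' ↔ ∃ y, z ∈ E y := by intro z; simp [hF']
  obtain ⟨M, hM⟩ := exists_nat_ge (Real.logb 2 F'.card / ε)
  set m' := max (max M (m + 1)) (Finset.univ.sup n + 1) with hm'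
  have hF'ne : F'.Nonempty := by
    obtain ⟨y, hy⟩ := hFne
    obtain ⟨z, hz⟩ := hEne ⟨y, hy⟩
    exact ⟨z, (hmem z).2 ⟨_, hz⟩⟩
  refine ⟨⟨⟨F', ?_, hF'ne⟩, m'⟩, ?_, ?_, ?_, ?_, ?_, ?_⟩
  · intro z hz
    obtain ⟨y, hy⟩ := (hmem z).1 hz
    exact hEL y hy
  · show m < m'
    have : m + 1 ≤ m' := (le_max_right _ _).trans (le_max_left _ _)
    omega
  · show (F'.card : ℝ) ≤ (2 : ℝ) ^ (ε * m')
    have hc : (0 : ℝ) < F'.card := by exact_mod_cast Finset.card_pos.2 hF'ne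
    rw [← Real.logb_le_iff_le_rpow (by norm_num) hc, ← div_le_iff₀' hε]
    refine hM.trans ?_
    exact_mod_cast (le_max_left M (m+1)).trans (le_max_left _ _)
  · intro z hz
    obtain ⟨y, hy⟩ := (hmem z).1 hz
    exact ⟨y.1, y.2, hd y z hy⟩
  · intro y hy
    obtain ⟨z, hz⟩ := hEne ⟨y, hy⟩
    exact ⟨z, (hmem z).2 ⟨_, hz⟩, hd _ z hz⟩
  · intro j hj hj'
    have h1 : VV F' m' ⊆ ⋃ y ∈ (Finset.univ : Finset F), VV (E y) m' := by
      intro x hx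
      simp only [VV, mem_iUnion] at hx ⊢
      obtain ⟨z, hz, hxz⟩ := hx
      obtain ⟨y, hy⟩ := (hmem z).1 hz
      exact ⟨y, Finset.mem_univ _, z, hy, hxz⟩
    have h2 := (coverNum_mono h1 j).trans (coverNum_biUnion _ _ j)
    calc (coverNum (VV F' m') j : ℝ) ≤ ∑ y : F, (coverNum (VV (E y) m') j : ℝ) := by exact_mod_cast h2
      _ ≤ ∑ y : F, 2 * (2 : ℝ) ^ (t * (j + 1)) :=
          Finset.sum_le_sum (fun y _ => hcov y j m' hj hj')
      _ = _ := by simp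
  · intro y hy
    refine ⟨n ⟨y, hy⟩, hmn _, ?_⟩
    intro T hT
    refine (hcard ⟨y, hy⟩).trans ?_
    have hn : n ⟨y, hy⟩ + 1 ≤ m' := by
      have h1 : n ⟨y, hy⟩ ≤ Finset.univ.sup n := Finset.le_sup (Finset.mem_univ _)
      have h2 := le_max_right (max M (m + 1)) (Finset.univ.sup n + 1)
      omega
    exact_mod_cast card_le_coverNum (E ⟨y, hy⟩) (n ⟨y, hy⟩) m' hn (hsep _) T
      (fun z hz => hT z ((hmem z).2 ⟨_, hz⟩) (hd _ z hz))

end asym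

section cantor
set_option linter.unusedSectionVars false
variable {K : Type*} [MetricSpace K] [CompactSpace K]

lemma VV_closed (F : Finset K) (m : ℕ) : IsClosed (VV F m) :=
  isClosed_biUnion_finset (fun _ _ => Metric.isClosed_closedBall)

lemma ball_nest {y z : K} {m m' : ℕ} (hm : m < m') (h : dist z y ≤ rd (m + 2)) :
    Metric.closedBall z (rd (m' + 1)) ⊆ Metric.closedBall y (rd (m + 1)) := by
  apply Metric.closedBall_subset_closedBall'
  have h1 : rd (m' + 1) ≤ rd (m + 2) := rd_anti (by omega)
  have h2 := rd_succ (m + 1)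
  rw [show m + 1 + 1 = m + 2 from rfl] at h2
  linarith

lemma cantor (L : Set K) (hLne : L.Nonempty) (s : ℝ)
    (hL : ∀ U, IsOpen U → (L ∩ U).Nonempty → ENNReal.ofReal s ≤ ubDim (L ∩ U)) :
    ∃ C : (ℕ → Icc (0 : ℝ) s) → Set K,
      (∀ τ, IsClosed (C τ)) ∧ (∀ τ, (C τ).Nonempty) ∧
      (∀ τ, C τ ⊆ closure L) ∧
      (∀ τ τ' k, (∀ i < k, τ i = τ' i) → ∀ c ∈ C τ, ∃ c' ∈ C τ', dist c c' ≤ rd k) ∧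
      (∀ τ (h : ℝ), Tendsto (fun k => (τ k : ℝ)) atTop (nhds h) →
        packDim (C τ) = ENNReal.ofReal h) := by
  classical
  obtain ⟨y0, hy0⟩ := hLne
  choose step hlt hcard hback hforw hcov hlow using step_all L s hL
  let ep : ℕ → {e : ℝ // 0 < e} := fun k => ⟨1 / ((k : ℝ) + 1), by positivity⟩
  let St : (ℕ → Icc (0 : ℝ) s) → ℕ → {F : Finset K // (F : Set K) ⊆ L ∧ F.Nonempty} × ℕ :=
    fun τ k => Nat.rec (⟨{y0}, by simpa using hy0, by simp⟩, 0)
      (fun k S => step S (ep k) (τ k)) k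
  have hSt : ∀ τ k, St τ (k + 1) = step (St τ k) (ep k) (τ k) := fun _ _ => rfl
  have hloc : ∀ τ τ' k, (∀ i < k, τ i = τ' i) → St τ k = St τ' k := by
    intro τ τ' k
    induction k with
    | zero => intro _; rfl
    | succ k ih =>
      intro h
      rw [hSt, hSt, ih (fun i hi => h i (by omega)), h k (by omega)]
  let m : (ℕ → Icc (0 : ℝ) s) → ℕ → ℕ := fun τ k => (St τ k).2
  have hm : ∀ τ k, m τ k < m τ (k + 1) := fun τ k => hlt _ _ _
  have hmono : ∀ τ, StrictMono (m τ) := fun τ => strictMono_nat_of_lt_succ (hm τ)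
  have hmk : ∀ τ k, k ≤ m τ k := fun τ k => (hmono τ).le_apply
  let F : (ℕ → Icc (0 : ℝ) s) → ℕ → Finset K := fun τ k => (St τ k).1.1
  have hFL : ∀ τ k, (F τ k : Set K) ⊆ L := fun τ k => (St τ k).1.2.1
  have hFne : ∀ τ k, (F τ k).Nonempty := fun τ k => (St τ k).1.2.2
  have hback' : ∀ τ k, ∀ z ∈ F τ (k + 1), ∃ y ∈ F τ k, dist z y ≤ rd (m τ k + 2) :=
    fun τ k => hback (St τ k) (ep k) (τ k)
  have hforw' : ∀ τ k, ∀ y ∈ F τ k, ∃ z ∈ F τ (k + 1), dist z y ≤ rd (m τ k + 2) :=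
    fun τ k => hforw (St τ k) (ep k) (τ k)
  have hcard' : ∀ τ k, ((F τ (k + 1)).card : ℝ) ≤ 2 ^ ((ep k).1 * (m τ (k + 1))) :=
    fun τ k => hcard (St τ k) (ep k) (τ k)
  have hcov' : ∀ τ k, ∀ j, m τ k ≤ j → j ≤ m τ (k + 1) →
      (coverNum (VV (F τ (k + 1)) (m τ (k + 1))) j : ℝ) ≤
        (F τ k).card * (2 * (2 : ℝ) ^ ((τ k).1 * (j + 1))) :=
    fun τ k => hcov (St τ k) (ep k) (τ k)
  have hlow' : ∀ τ k, ∀ y ∈ F τ k, ∃ n, m τ k + 1 ≤ n ∧ ∀ T : Set K,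
        (∀ z ∈ F τ (k + 1), dist z y ≤ rd (m τ k + 2) →
          (T ∩ Metric.closedBall z (rd (m τ (k + 1) + 1))).Nonempty) →
        (2 : ℝ) ^ (((τ k).1 - (ep k).1) * n) ≤ coverNum T (n + 2) :=
    fun τ k => hlow (St τ k) (ep k) (τ k)
  have hlocF : ∀ τ τ' k, (∀ i < k, τ i = τ' i) → F τ k = F τ' k := fun τ τ' k h => by
    show (St τ k).1.1 = (St τ' k).1.1
    rw [hloc τ τ' k h]
  have hlocm : ∀ τ τ' k, (∀ i < k, τ i = τ' i) → m τ k = m τ' k := fun τ τ' k h => by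
    show (St τ k).2 = (St τ' k).2
    rw [hloc τ τ' k h]
  have hep : Tendsto (fun k => (ep k).1) atTop (nhds 0) := tendsto_one_div_add_atTop_nhds_zero_nat
  clear_value F m ep
  clear hback hforw hcard hcov hlow hlt hloc hSt
  clear St
  let V : (ℕ → Icc (0 : ℝ) s) → ℕ → Set K := fun τ k => VV (F τ k) (m τ k)
  have hVmem : ∀ τ k x, x ∈ V τ k ↔ ∃ y ∈ F τ k, dist x y ≤ rd (m τ k + 1) := by
    intro τ k x
    simp [V, VV]
  have hVclosed : ∀ τ k, IsClosed (V τ k) := fun τ k => VV_closed _ _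
  have hVanti : ∀ τ, Antitone (V τ) := by
    intro τ
    apply antitone_nat_of_succ_le
    intro k x hx
    rw [hVmem] at hx
    obtain ⟨z, hz, hxz⟩ := hx
    obtain ⟨y, hy, hyz⟩ := hback' τ k z hz
    rw [hVmem]
    exact ⟨y, hy, ball_nest (hm τ k) hyz hxz⟩
  have hmeet : ∀ τ k, ∀ y ∈ F τ k, ((⋂ k, V τ k) ∩ Metric.closedBall y (rd (m τ k + 1))).Nonempty := by
    intro τ k y hy
    have h1 : ∀ i, ∃ z ∈ F τ (k + i), Metric.closedBall z (rd (m τ (k + i) + 1)) ⊆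
        Metric.closedBall y (rd (m τ k + 1)) := by
      intro i
      induction i with
      | zero => exact ⟨y, hy, subset_rfl⟩
      | succ i ih =>
        obtain ⟨z, hz, hsub⟩ := ih
        obtain ⟨w, hw, hwz⟩ := hforw' τ (k + i) z hz
        exact ⟨w, hw, (ball_nest (hm τ (k + i)) hwz).trans hsub⟩
    have h2 : (⋂ i, V τ (k + i) ∩ Metric.closedBall y (rd (m τ k + 1))).Nonempty := by
      apply IsCompact.nonempty_iInter_of_sequence_nonempty_isCompact_isClosed
      · intro i
        exact inter_subset_inter_left _ (hVanti τ (by omega))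
      · intro i
        obtain ⟨z, hz, hsub⟩ := h1 i
        have hzz : z ∈ Metric.closedBall z (rd (m τ (k + i) + 1)) :=
          Metric.mem_closedBall_self (rd_pos _).le
        exact ⟨z, (hVmem _ _ _).2 ⟨z, hz, hzz⟩, hsub hzz⟩
      · exact ((hVclosed _ _).inter Metric.isClosed_closedBall).isCompact
      · intro i
        exact (hVclosed _ _).inter Metric.isClosed_closedBall
    obtain ⟨x, hx⟩ := h2
    rw [mem_iInter] at hx
    refine ⟨x, mem_iInter.2 fun j => hVanti τ (Nat.le_add_left j k) (hx j).1, (hx 0).2⟩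
  have hclosed : ∀ τ, IsClosed (⋂ k, V τ k) := fun τ => isClosed_iInter (hVclosed τ)
  have hne : ∀ τ, (⋂ k, V τ k).Nonempty := by
    intro τ
    obtain ⟨y, hy⟩ := hFne τ 0
    exact (hmeet τ 0 y hy).mono inter_subset_left
  refine ⟨fun τ => ⋂ k, V τ k, hclosed, hne, ?_, ?_, ?_⟩
  · intro τ x hx
    rw [Metric.mem_closure_iff]
    intro ε hε
    obtain ⟨k, hk⟩ := rd_lt ε hε
    obtain ⟨y, hy, hxy⟩ := (hVmem _ _ _).1 (mem_iInter.1 hx k)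
    refine ⟨y, hFL τ k hy, lt_of_le_of_lt (hxy.trans (rd_anti ?_)) hk⟩
    have := hmk τ k
    omega
  · intro τ τ' k hag c hc
    obtain ⟨y, hy, hxy⟩ := (hVmem _ _ _).1 (mem_iInter.1 hc k)
    have hy' : y ∈ F τ' k := by rw [← hlocF τ τ' k hag]; exact hy
    obtain ⟨c', hc', hcy⟩ := hmeet τ' k y hy'
    refine ⟨c', hc', ?_⟩
    have hmm : m τ' k = m τ k := (hlocm τ τ' k hag).symm
    rw [hmm, Metric.mem_closedBall] at hcy
    have h1 := dist_triangle_right c c' y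
    have h2 := rd_succ (m τ k)
    have h3 := rd_anti (hmk τ k)
    linarith
  · intro τ h hτ
    have h0 : 0 ≤ h := ge_of_tendsto' hτ (fun k => (τ k).2.1)
    apply le_antisymm
    · refine (packDim_le_ubDim _).trans (ubDim_le_of_event _ h h0 ?_)
      intro a ha
      have h1 : Tendsto (fun k => (τ (k + 1) : ℝ) + (ep k).1) atTop (nhds h) := by
        simpa using (hτ.comp (tendsto_add_atTop_nat 1)).add hep
      obtain ⟨k0, hk0⟩ := Filter.eventually_atTop.1 (h1.eventually_lt_const ha)
      refine ⟨m τ (k0 + 1), ?_⟩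
      intro j hj
      have hex : ∃ k, j < m τ k := ⟨j + 1, by have := hmk τ (j + 1); omega⟩
      obtain ⟨k, hk, hkj, hjk⟩ : ∃ k, k0 ≤ k ∧ m τ (k + 1) ≤ j ∧ j < m τ (k + 2) := by
        have h2 := Nat.find_spec hex
        have h3 : k0 + 1 < Nat.find hex := by
          by_contra hcon
          have := (hmono τ).monotone (not_lt.1 hcon)
          omega
        obtain ⟨k, hk⟩ : ∃ k, Nat.find hex = k + 2 := ⟨Nat.find hex - 2, by omega⟩
        refine ⟨k, by omega, ?_, hk ▸ h2⟩
        have := Nat.find_min hex (m := k + 1) (by omega)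
        omega
      have h4 := hcov' τ (k + 1) j hkj hjk.le
      have h5 : ((F τ (k + 1)).card : ℝ) ≤ 2 ^ ((ep k).1 * (m τ (k + 1))) := hcard' τ k
      have h6 : (coverNum (⋂ k, V τ k) j : ℝ) ≤ coverNum (V τ (k + 2)) j := by
        exact_mod_cast coverNum_mono (iInter_subset _ _) j
      have hkj' : (m τ (k + 1) : ℝ) ≤ j := by exact_mod_cast hkj
      have hepp := (ep k).2
      calc (coverNum (⋂ k, V τ k) j : ℝ) ≤ coverNum (V τ (k + 2)) j := h6
        _ ≤ (F τ (k + 1)).card * (2 * (2 : ℝ) ^ ((τ (k + 1)).1 * (j + 1))) := h4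
        _ ≤ 2 ^ ((ep k).1 * (m τ (k + 1))) * (2 * (2 : ℝ) ^ ((τ (k + 1)).1 * (j + 1))) := by
            gcongr
        _ = 2 * 2 ^ ((ep k).1 * (m τ (k + 1)) + (τ (k + 1)).1 * (j + 1)) := by
            rw [Real.rpow_add (by norm_num)]; ring
        _ ≤ 2 * 2 ^ (a * (j + 1)) := by
            gcongr
            · norm_num
            · have := hk0 k hk
              have h7 : (ep k).1 * (m τ (k + 1)) ≤ (ep k).1 * (j + 1) := by
                gcongr; linarith
              have h8 : (0 : ℝ) < (j : ℝ) + 1 := by positivity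
              nlinarith
    · apply le_packDim_of_baire _ (hclosed τ) (hne τ)
      rintro U hU ⟨c, hc, hcU⟩
      apply le_ubDim_of_freq
      intro b hb M
      obtain ⟨ε, hε, hball⟩ := Metric.isOpen_iff.1 hU c hcU
      obtain ⟨k1, hk1⟩ := rd_lt ε hε
      have h1 : Tendsto (fun k => (τ k : ℝ) - (ep k).1) atTop (nhds h) := by
        simpa using hτ.sub hep
      obtain ⟨k0, hk0⟩ := Filter.eventually_atTop.1 (h1.eventually_const_lt hb)
      set k := max (max k0 k1) M with hk
      have hkk0 : k0 ≤ k := (le_max_left _ _).trans (le_max_left _ _)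
      have hkk1 : k1 ≤ k := (le_max_right _ _).trans (le_max_left _ _)
      have hkM : M ≤ k := le_max_right _ _
      obtain ⟨y, hy, hcy⟩ := (hVmem _ _ _).1 (mem_iInter.1 hc k)
      obtain ⟨n, hn, hT⟩ := hlow' τ k y hy
      have hn' : m τ k + 1 ≤ n := hn
      have hmkk := hmk τ k
      refine ⟨n, by omega, ?_⟩
      refine le_trans ?_ (hT ((⋂ k, V τ k) ∩ U) ?_)
      · apply Real.rpow_le_rpow_of_exponent_le (by norm_num)
        have := hk0 k hkk0
        gcongr
      · intro z hz hzy
        obtain ⟨x, hx, hxz⟩ := hmeet τ (k + 1) z hz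
        refine ⟨x, ⟨hx, hball ?_⟩, hxz⟩
        have hxy := ball_nest (hm τ k) hzy hxz
        rw [Metric.mem_closedBall] at hxy
        rw [Metric.mem_ball]
        have h2 := dist_triangle_right x c y
        have h3 := rd_succ (m τ k)
        have h4 : rd (m τ k) ≤ rd k1 := rd_anti (by omega)
        linarith

end cantor

section coding

lemma coding (A : Set ℝ) (han : MeasureTheory.AnalyticSet A) (hne : A.Nonempty) :
    ∃ (g : ℕ → (ℕ → Bool) → ℝ) (G : (ℕ → Bool) → ℝ),
      (∀ k x, g k x ∈ A) ∧
      (∀ k x y, (∀ i < k, x i = y i) → g k x = g k y) ∧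
      (∀ x, Tendsto (fun k => g k x) atTop (nhds (G x))) ∧ range G = A := by
  rw [MeasureTheory.AnalyticSet] at han
  rcases han with h | ⟨f, hf, hfA⟩
  · exact absurd h hne.ne_empty
  let al : ℕ → (ℕ → Bool) → ℕ → ℕ := fun k x i =>
    sInf {j | Nat.pair i j < k ∧ x (Nat.pair i j) = true}
  let be : (ℕ → Bool) → ℕ → ℕ := fun x i => sInf {j | x (Nat.pair i j) = true}
  refine ⟨fun k x => f (al k x), fun x => f (be x), ?_, ?_, ?_, ?_⟩
  · intro k x; rw [← hfA]; exact mem_range_self _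
  · intro k x y hxy
    have : al k x = al k y := by
      funext i
      show sInf _ = sInf _
      congr 1
      ext j
      constructor
      · rintro ⟨h1, h2⟩; exact ⟨h1, by rw [← hxy _ h1]; exact h2⟩
      · rintro ⟨h1, h2⟩; exact ⟨h1, by rw [hxy _ h1]; exact h2⟩
    show f _ = f _
    rw [this]
  · intro x
    refine (hf.tendsto (be x)).comp ?_
    rw [tendsto_pi_nhds]
    intro i
    apply tendsto_const_nhds.congr'
    by_cases hex : {j | x (Nat.pair i j) = true}.Nonempty
    · filter_upwards [Filter.eventually_gt_atTop (Nat.pair i (be x i))] with k hk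
      have hmem : be x i ∈ {j | Nat.pair i j < k ∧ x (Nat.pair i j) = true} :=
        ⟨hk, Nat.sInf_mem hex⟩
      apply le_antisymm
      · exact Nat.sInf_le (Nat.sInf_mem ⟨_, hmem⟩ : sInf _ ∈ _).2
      · exact Nat.sInf_le hmem
    · rw [not_nonempty_iff_eq_empty] at hex
      apply Filter.Eventually.of_forall
      intro k
      have h1 : {j | Nat.pair i j < k ∧ x (Nat.pair i j) = true} = ∅ := by
        rw [Set.eq_empty_iff_forall_notMem] at hex ⊢
        rintro j ⟨_, h⟩
        exact hex j h
      show sInf _ = sInf _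
      rw [hex, h1]
  · rw [← hfA]
    apply Subset.antisymm
    · rintro _ ⟨x, rfl⟩; exact mem_range_self _
    · rintro _ ⟨β, rfl⟩
      refine ⟨fun n => decide (n.unpair.2 = β n.unpair.1), ?_⟩
      show f _ = f _
      congr 1
      funext i
      show sInf _ = _
      have : {j | decide ((Nat.pair i j).unpair.2 = β (Nat.pair i j).unpair.1) = true} = {β i} := by
        ext j; simp
      rw [this, csInf_singleton]

end coding
/-- Given a nonempty compact metric space `K` and an analytic set `A ⊆ [0, dim_P K]`,
there is a family `𝒞` of nonempty compact subsets of `K`, compact in the Hausdorff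
metric, whose members attain exactly the packing dimensions in `A`. -/
theorem statement10 (K : Type*) [MetricSpace K] [CompactSpace K] [Nonempty K]
    (A : Set ℝ) (han : MeasureTheory.AnalyticSet A)
    (hsub : ∀ a ∈ A, 0 ≤ a ∧ ENNReal.ofReal a ≤ packDim (Set.univ : Set K)) :
    ∃ 𝒞 : Set (TopologicalSpace.NonemptyCompacts K),
      IsCompact 𝒞 ∧
      {e : ℝ≥0∞ | ∃ C ∈ 𝒞, packDim (C : Set K) = e} = ENNReal.ofReal '' A := by
  classical
  rcases A.eq_empty_or_nonempty with hA | hA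
  · subst hA
    exact ⟨∅, isCompact_empty, by simp⟩
  obtain ⟨g, G, hgA, hgloc, hgG, hGA⟩ := coding A han hA
  obtain ⟨p, hp⟩ := exists_point (K := K)
  obtain ⟨s, hs0, hsd, hss⟩ : ∃ s : ℕ → ℝ, (∀ i, 0 ≤ s i) ∧
      (∀ i, ENNReal.ofReal (s i) < packDim (univ : Set K) ∨ s i = 0) ∧
      ∀ c < packDim (univ : Set K), ∃ i, c < ENNReal.ofReal (s i) := by
    rcases eq_or_ne (packDim (univ : Set K)) 0 with h0 | h0
    · refine ⟨fun _ => 0, fun _ => le_rfl, fun _ => Or.inr rfl, ?_⟩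
      intro c hc
      rw [h0] at hc
      exact absurd hc not_lt_zero
    · obtain ⟨u, -, hu, hut⟩ := exists_seq_strictMono_tendsto' (bot_lt_iff_ne_bot.2 h0)
      have hof : ∀ i, ENNReal.ofReal (u i).toReal = u i := fun i =>
        ENNReal.ofReal_toReal ((hu i).2.trans_le le_top).ne
      refine ⟨fun i => (u i).toReal, fun _ => ENNReal.toReal_nonneg, fun i => Or.inl ?_, ?_⟩
      · rw [hof]; exact (hu i).2
      · intro c hc
        obtain ⟨i, hi⟩ := (hut.eventually_const_lt hc).exists
        exact ⟨i, by rw [hof]; exact hi⟩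
  have hcore : ∀ i, ∃ L ⊆ Metric.ball p (rd i), L.Nonempty ∧
      ∀ U, IsOpen U → (L ∩ U).Nonempty → ENNReal.ofReal (s i) ≤ ubDim (L ∩ U) := by
    intro i
    rcases hsd i with h | h
    · exact exists_core _ Metric.isOpen_ball _
        (h.trans_le (hp _ (Metric.ball_mem_nhds p (rd_pos i))))
    · refine ⟨{p}, by simpa using rd_pos i, by simp, ?_⟩
      intro U _ _
      rw [h, ENNReal.ofReal_zero]
      exact zero_le
  choose L hLp hLne hL using hcore
  choose C hCc hCne hCL hCloc hCdim using fun i => cantor (L i) (hLne i) (s i) (hL i)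
  let τ : ∀ i : ℕ, (ℕ → Bool) → ℕ → Icc (0 : ℝ) (s i) := fun i x k =>
    ⟨min (g k x) (s i), le_min (hsub _ (hgA k x)).1 (hs0 i), min_le_right _ _⟩
  have hτG : ∀ i x, packDim (C i (τ i x)) = ENNReal.ofReal (min (G x) (s i)) := by
    intro i x
    apply hCdim
    exact (hgG x).min tendsto_const_nhds
  have hτloc : ∀ i x y k, (∀ j < k, x j = y j) → ∀ c ∈ C i (τ i x), ∃ c' ∈ C i (τ i y),
      dist c c' ≤ rd k := by
    intro i x y k hxy
    apply hCloc
    intro j hj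
    apply Subtype.ext
    show min (g j x) (s i) = min (g j y) (s i)
    rw [hgloc j x y (fun l hl => hxy l (by omega))]
  have hCp : ∀ i x, C i (τ i x) ⊆ Metric.closedBall p (rd i) := fun i x =>
    (hCL i _).trans (closure_minimal ((hLp i).trans Metric.ball_subset_closedBall)
      Metric.isClosed_closedBall)
  let D : (ℕ → Bool) → Set K := fun x => {p} ∪ ⋃ i, C i (τ i x)
  have hDc : ∀ x, IsClosed (D x) := by
    intro x
    have : D x = ⋂ N : ℕ, (Metric.closedBall p (rd N) ∪ ⋃ i ∈ Finset.range N, C i (τ i x)) := by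
      apply Subset.antisymm
      · rintro q (hq | hq)
        · rw [mem_singleton_iff] at hq
          subst hq
          exact mem_iInter.2 fun N => Or.inl (Metric.mem_closedBall_self (rd_pos N).le)
        · obtain ⟨i, hi⟩ := mem_iUnion.1 hq
          refine mem_iInter.2 fun N => ?_
          rcases lt_or_ge i N with h | h
          · exact Or.inr (mem_iUnion₂.2 ⟨i, Finset.mem_range.2 h, hi⟩)
          · exact Or.inl (Metric.closedBall_subset_closedBall (rd_anti h) (hCp i x hi))
      · intro q hq
        by_cases hqp : q = p
        · exact Or.inl hqp
        · obtain ⟨N, hN⟩ := rd_lt (dist q p) (dist_pos.2 hqp)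
          rcases mem_iInter.1 hq N with h | h
          · exact absurd (Metric.mem_closedBall.1 h) (not_le.2 hN)
          · obtain ⟨i, _, hi⟩ := mem_iUnion₂.1 h
            exact Or.inr (mem_iUnion.2 ⟨i, hi⟩)
    rw [this]
    exact isClosed_iInter fun N => Metric.isClosed_closedBall.union
      (isClosed_biUnion_finset fun i _ => hCc i _)
  have hDloc : ∀ x y k, (∀ j < k, x j = y j) → ∀ c ∈ D x, ∃ c' ∈ D y, dist c c' ≤ rd k := by
    rintro x y k hxy c (hc | hc)
    · refine ⟨p, Or.inl rfl, ?_⟩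
      rw [mem_singleton_iff.1 hc, dist_self]
      exact (rd_pos k).le
    · obtain ⟨i, hi⟩ := mem_iUnion.1 hc
      obtain ⟨c', hc', hd⟩ := hτloc i x y k hxy c hi
      exact ⟨c', Or.inr (mem_iUnion.2 ⟨i, hc'⟩), hd⟩
  have hDdim : ∀ x, packDim (D x) = ENNReal.ofReal (G x) := by
    intro x
    apply le_antisymm
    · apply packDim_union_le
      · rw [packDim_singleton]; exact zero_le
      · apply packDim_iUnion_le
        intro i
        rw [hτG]
        exact ENNReal.ofReal_le_ofReal (min_le_left _ _)
    · apply le_of_forall_lt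
      intro c hc
      have hGx : G x ∈ A := hGA ▸ mem_range_self x
      obtain ⟨i, hi⟩ := hss c (hc.trans_le (hsub _ hGx).2)
      refine lt_of_lt_of_le ?_ (packDim_mono (show C i (τ i x) ⊆ D x from
        (subset_iUnion (fun i => C i (τ i x)) i).trans subset_union_right))
      rw [hτG]
      rcases min_choice (G x) (s i) with h | h <;> rw [h] <;> assumption
  let Φ : (ℕ → Bool) → TopologicalSpace.NonemptyCompacts K := fun x =>
    ⟨⟨D x, (hDc x).isCompact⟩, ⟨p, Or.inl rfl⟩⟩
  have hΦ : Continuous Φ := by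
    rw [continuous_iff_continuousAt]
    intro x
    rw [ContinuousAt, Metric.tendsto_nhds]
    intro ε hε
    obtain ⟨k, hk⟩ := rd_lt ε hε
    have hev : ∀ᶠ y in nhds x, ∀ j ∈ Finset.range k, y j = x j := by
      rw [Filter.eventually_all_finset]
      intro j _
      have h1 : Tendsto (fun y : ℕ → Bool => y j) (nhds x) (nhds (x j)) :=
        (continuous_apply j).tendsto x
      rw [nhds_discrete Bool, tendsto_pure] at h1
      exact h1
    filter_upwards [hev] with y hy
    have hy' : ∀ j < k, y j = x j := fun j hj => hy j (Finset.mem_range.2 hj)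
    refine lt_of_le_of_lt ?_ hk
    show Metric.hausdorffDist (D y) (D x) ≤ rd k
    exact Metric.hausdorffDist_le_of_mem_dist (rd_pos k).le (hDloc y x k hy')
      (hDloc x y k fun j hj => (hy' j hj).symm)
  refine ⟨range Φ, isCompact_range hΦ, ?_⟩
  ext e
  constructor
  · rintro ⟨_, ⟨x, rfl⟩, rfl⟩
    exact ⟨G x, hGA ▸ mem_range_self x, (hDdim x).symm⟩
  · rintro ⟨a, ha, rfl⟩
    rw [← hGA] at ha
    obtain ⟨x, rfl⟩ := ha
    exact ⟨Φ x, mem_range_self x, hDdim x⟩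
end

section
/- Let A ⊆ [0,∞) be a nonempty analytic set. Then there exists a map φ : 2^{<ω} → [0,∞) defined on all finite binary strings such that for every x ∈ 2^ω the limit φ̄(x) = lim_{n→∞} φ(x↾n) exists (where x↾n is the initial segment of x of length n), and { φ̄(x) : x ∈ 2^ω } = A. -/
open Filter MeasureTheory Set
open scoped ENNReal

/-- For every nonempty analytic set `A ⊆ [0,∞)` there is a map `φ` from finite binary
strings to `[0,∞)` such that for every `x ∈ 2^ω` the limit `φ̄(x) = lim_n φ(x↾n)` exists,
and the set of values of `φ̄` is exactly `A`. -/
theorem statement12 (A : Set ℝ) (hne : A.Nonempty) (hsub : A ⊆ Set.Ici (0 : ℝ))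
    (han : MeasureTheory.AnalyticSet A) :
    ∃ φ : List Bool → ℝ, (∀ s, 0 ≤ φ s) ∧
      ∃ φbar : (ℕ → Bool) → ℝ,
        (∀ x : ℕ → Bool,
          Filter.Tendsto (fun n => φ (List.ofFn fun i : Fin n => x i))
            Filter.atTop (nhds (φbar x))) ∧
        Set.range φbar = A := by
  rw [MeasureTheory.AnalyticSet] at han
  rcases han with h | ⟨f, hf, hA⟩
  · exact absurd h hne.ne_empty
  have hget : ∀ (x : ℕ → Bool) (n j : ℕ),
      (List.ofFn fun i : Fin n => x i).getD j false = true ↔ (j < n ∧ x j = true) := by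
    intro x n j
    by_cases h : j < n <;> simp [List.getD_eq_getElem?_getD, List.getElem?_ofFn, h]
  refine ⟨fun t => f fun k => sInf {m | t.getD (Nat.pair k m) false = true}, ?_,
    fun x => f fun k => sInf {m | x (Nat.pair k m) = true}, ?_, ?_⟩
  · intro s
    exact hsub (hA ▸ mem_range_self _)
  · intro x
    refine (hf.tendsto _).comp ?_
    rw [tendsto_pi_nhds]
    intro k
    apply tendsto_const_nhds.congr'
    simp only [hget]
    by_cases hk : {m | x (Nat.pair k m) = true}.Nonempty
    · have h0 := Nat.sInf_mem hk
      filter_upwards [eventually_gt_atTop (Nat.pair k (sInf {m | x (Nat.pair k m) = true}))]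
        with n hn
      apply le_antisymm
      · exact Nat.sInf_le (Nat.sInf_mem (s := {m | Nat.pair k m < n ∧ x (Nat.pair k m) = true})
          ⟨_, hn, h0⟩).2
      · exact Nat.sInf_le ⟨hn, h0⟩
    · refine Eventually.of_forall fun n => ?_
      have : ∀ m, ¬ x (Nat.pair k m) = true := fun m h => hk ⟨m, h⟩
      simp [this]
  · rw [← hA]
    apply Subset.antisymm
    · rintro _ ⟨x, rfl⟩
      exact mem_range_self _
    · rintro _ ⟨y, rfl⟩
      refine ⟨fun j => decide (j.unpair.2 = y j.unpair.1), ?_⟩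
      simp
end

section
/- Let 0 ≤ a ≤ b ≤ 1 and let α, β ∈ 2^ω be balanced sequences with density ρ(α) = a and ρ(β) = b. For each n let x_n ∈ 2^ω be an infinite concatenation x_n = s_n^0 ⌢ s_n^1 ⌢ s_n^2 ⌢ ⋯ of finite binary strings, where each s_n^k is a contiguous block of α or a contiguous block of β. Suppose that length(s_n^1) → ∞ as n → ∞ and that x_n → x in 2^ω. Then the density ρ(x) exists and ρ(x) ∈ {a, b}. -/
open Filter Set

/-- The digit sum of a finite binary string. -/
def digitSum (s : List Bool) : ℕ := (s.map fun b => if b then 1 else 0).sum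

/-- `s` is a contiguous block of `x ∈ 2^ω`. -/
def IsBlock (s : List Bool) (x : ℕ → Bool) : Prop :=
  ∃ k, s = List.ofFn fun i : Fin s.length => x (k + i)

/-- `x ∈ 2^ω` is balanced: any two contiguous blocks of the same length have digit sums
differing by at most 1. -/
def BalancedSeq (x : ℕ → Bool) : Prop :=
  ∀ s t : List Bool, IsBlock s x → IsBlock t x → s.length = t.length →
    |(digitSum s : ℤ) - (digitSum t : ℤ)| ≤ 1

/-- `x ∈ 2^ω` has density `a`: the averages of the first `n` digits converge to `a`. -/
def HasDensity (x : ℕ → Bool) (a : ℝ) : Prop :=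
  Filter.Tendsto
    (fun n => (∑ i ∈ Finset.range n, (if x i then (1 : ℝ) else 0)) / n)
    Filter.atTop (nhds a)

def tsum13 (y : ℕ → Bool) (k N : ℕ) : ℝ := ∑ i ∈ Finset.range N, (if y (k + i) then (1 : ℝ) else 0)

lemma tsum13_nonneg (y : ℕ → Bool) (k N : ℕ) : 0 ≤ tsum13 y k N :=
  Finset.sum_nonneg fun i _ => by split_ifs <;> norm_num

lemma tsum13_le (y : ℕ → Bool) (k N : ℕ) : tsum13 y k N ≤ N := by
  have h : tsum13 y k N ≤ ∑ i ∈ Finset.range N, (1 : ℝ) :=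
    Finset.sum_le_sum fun i _ => by split_ifs <;> norm_num
  simpa using h

lemma tsum13_add (y : ℕ → Bool) (k M N : ℕ) :
    tsum13 y k (M + N) = tsum13 y k M + tsum13 y (k + M) N := by
  unfold tsum13
  rw [Finset.sum_range_add]
  simp [add_assoc]

lemma digitSum13 (y : ℕ → Bool) (k N : ℕ) :
    (digitSum (List.ofFn fun i : Fin N => y (k + i)) : ℝ) = tsum13 y k N := by
  unfold digitSum tsum13
  rw [List.map_ofFn, List.sum_ofFn, Finset.sum_range]
  push_cast
  simp

lemma balanced13 (y : ℕ → Bool) (hy : BalancedSeq y) (k l N : ℕ) :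
    |tsum13 y k N - tsum13 y l N| ≤ 1 := by
  have h := hy (List.ofFn fun i : Fin N => y (k + i)) (List.ofFn fun i : Fin N => y (l + i))
    ⟨k, by apply List.ext_get <;> simp⟩ ⟨l, by apply List.ext_get <;> simp⟩ (by simp)
  have h2 : ((|(digitSum (List.ofFn fun i : Fin N => y (k + i)) : ℤ)
     - (digitSum (List.ofFn fun i : Fin N => y (l + i)) : ℤ)| : ℤ) : ℝ) ≤ ((1 : ℤ) : ℝ) :=
    Int.cast_le.mpr h
  push_cast at h2
  rwa [digitSum13, digitSum13] at h2

lemma density13 (γ y : ℕ → Bool) (c : ℝ) (hγ : BalancedSeq γ) (hc : HasDensity γ c) (L : ℕ)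
    (h : ∀ N, ∃ k, ∀ i < N, y (L + i) = γ (k + i)) : HasDensity y c := by
  have key : ∀ N, |tsum13 y 0 N - tsum13 γ 0 N| ≤ L + 1 := by
    intro N
    obtain ⟨k, hk⟩ := h N
    have h1 : tsum13 y L N = tsum13 γ k N :=
      Finset.sum_congr rfl fun i hi => by rw [hk i (Finset.mem_range.mp hi)]
    have h2 := abs_le.mp (balanced13 γ hγ k 0 N)
    have h3 := tsum13_add y 0 L N
    have h4 := tsum13_add y 0 N L
    rw [add_comm N L] at h4
    rw [zero_add] at h3 h4
    have h5 := tsum13_nonneg y 0 L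
    have h6 := tsum13_nonneg y N L
    have h7 := tsum13_le y 0 L
    have h8 := tsum13_le y N L
    rw [abs_le]
    constructor <;> linarith
  have e : ∀ z : ℕ → Bool, (fun n : ℕ => (∑ i ∈ Finset.range n, (if z i then (1 : ℝ) else 0)) / n)
      = fun n : ℕ => tsum13 z 0 n / n := by
    intro z; unfold tsum13; simp
  unfold HasDensity at *
  rw [e] at *
  have h0 : Tendsto (fun n : ℕ => tsum13 y 0 n / n - tsum13 γ 0 n / n) atTop (nhds 0) := by
    apply squeeze_zero_norm (a := fun n : ℕ => ((L : ℝ) + 1) / n)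
    · intro n
      rw [← sub_div, norm_div, Real.norm_eq_abs, Real.norm_natCast]
      exact div_le_div_of_nonneg_right (key n) (Nat.cast_nonneg n)
    · exact tendsto_const_div_atTop_nhds_zero_nat _
  simpa using h0.add hc

/-- Let `α, β ∈ 2^ω` be balanced with densities `a ≤ b` in `[0,1]`. Suppose each `x n ∈ 2^ω`
is the infinite concatenation of finite strings `s n 0, s n 1, s n 2, …`, each of which is
a contiguous block of `α` or of `β` (the concatenation being expressed via the partial
sums of lengths), `(s n 1).length → ∞`, and `x n → x` in the Cantor space. Then the
density of `x` exists and equals `a` or `b`. -/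
theorem statement13 (a b : ℝ) (ha : 0 ≤ a) (hab : a ≤ b) (hb : b ≤ 1)
    (α β : ℕ → Bool) (hα : BalancedSeq α) (hβ : BalancedSeq β)
    (hαden : HasDensity α a) (hβden : HasDensity β b)
    (s : ℕ → ℕ → List Bool)
    (hblock : ∀ n k, IsBlock (s n k) α ∨ IsBlock (s n k) β)
    (x : ℕ → ℕ → Bool) (xlim : ℕ → Bool)
    (hconcat : ∀ n k i (h : i < (s n k).length),
      x n ((∑ j ∈ Finset.range k, (s n j).length) + i) = (s n k).get ⟨i, h⟩)
    (hcover : ∀ n, Filter.Tendsto (fun k => ∑ j ∈ Finset.range k, (s n j).length)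
      Filter.atTop Filter.atTop)
    (hlen : Filter.Tendsto (fun n => (s n 1).length) Filter.atTop Filter.atTop)
    (hxlim : Filter.Tendsto x Filter.atTop (nhds xlim)) :
    ∃ ρ ∈ ({a, b} : Set ℝ), HasDensity xlim ρ := by
  have agree : ∀ N, ∀ᶠ n in atTop, ∀ i < N, x n i = xlim i := by
    intro N
    have h1 : ∀ i, ∀ᶠ n in atTop, x n i = xlim i := fun i => by
      have := (tendsto_pi_nhds.mp hxlim) i
      rw [nhds_discrete, tendsto_pure] at this
      exact this
    have h2 := (Filter.eventually_all_finset (Finset.range N)).mpr fun i _ => h1 i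
    filter_upwards [h2] with n hn i hi using hn i (Finset.mem_range.mpr hi)
  have main : ∀ (γ : ℕ → Bool) (L j : ℕ),
      (∀ N, ∃ᶠ n in atTop, (∑ i ∈ Finset.range j, (s n i).length = L ∧ IsBlock (s n j) γ) ∧
        N ≤ (s n j).length) →
      ∀ N, ∃ k, ∀ i < N, xlim (L + i) = γ (k + i) := by
    intro γ L j hf N
    obtain ⟨n, ⟨⟨hL, k, hk⟩, hN⟩, hag⟩ := ((hf N).and_eventually (agree (L + N))).exists
    refine ⟨k, fun i hi => ?_⟩
    have hi' : i < (s n j).length := lt_of_lt_of_le hi hN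
    rw [← hag (L + i) (by omega), ← hL, hconcat n j i hi']
    have h3 : (s n j)[i]? = (List.ofFn fun i : Fin (s n j).length => γ (k + i))[i]? :=
      congrArg (fun l => l[i]?) hk
    rw [List.getElem?_eq_getElem hi', List.getElem?_eq_getElem (by simpa using hi')] at h3
    simpa using h3
  have split : ∀ (j L : ℕ), (∃ᶠ n in atTop, ∑ i ∈ Finset.range j, (s n i).length = L) →
      Tendsto (fun n => (s n j).length) atTop atTop →
      ∃ ρ ∈ ({a, b} : Set ℝ), HasDensity xlim ρ := by
    intro j L hf ht
    have : ∃ᶠ n in atTop, ((∑ i ∈ Finset.range j, (s n i).length = L ∧ IsBlock (s n j) α) ∨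
        (∑ i ∈ Finset.range j, (s n i).length = L ∧ IsBlock (s n j) β)) :=
      hf.mono fun n hn => (hblock n j).imp (fun h => ⟨hn, h⟩) (fun h => ⟨hn, h⟩)
    rcases Filter.frequently_or_distrib.mp this with h | h
    · exact ⟨a, by simp, density13 α xlim a hα hαden L
        (main α L j fun N => h.and_eventually (ht.eventually_ge_atTop N))⟩
    · exact ⟨b, by simp, density13 β xlim b hβ hβden L
        (main β L j fun N => h.and_eventually (ht.eventually_ge_atTop N))⟩
  by_cases hc : ∃ L, ∃ᶠ n in atTop, (s n 0).length = L
  · obtain ⟨L, hL⟩ := hc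
    exact split 1 L (by simpa using hL) hlen
  · simp only [not_exists, Filter.not_frequently] at hc
    refine split 0 0 (Filter.Eventually.frequently (by simp)) (tendsto_atTop.mpr fun N => ?_)
    have h2 := (Filter.eventually_all_finset (Finset.range N)).mpr fun i _ => hc i
    filter_upwards [h2] with n hn
    by_contra hlt
    exact hn _ (Finset.mem_range.mpr (not_le.mp hlt)) rfl
end

section
/- Let α ∈ 2^ω be a balanced sequence whose density ρ(α) = a exists. Then for every n ≥ 1 and every contiguous block s = (α(k), α(k+1), …, α(k+n−1)) of α of length n, one has |a − (∑_{i=0}^{n−1} s(i))/n| ≤ 1/n. -/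
open Filter Set

theorem digitSum_ofFn_aux (x : ℕ → Bool) (n k : ℕ) :
    (digitSum (List.ofFn fun i : Fin n => x (k + i)) : ℝ)
      = ∑ i ∈ Finset.range n, (if x (k + i) then (1 : ℝ) else 0) := by
  unfold digitSum
  rw [List.map_ofFn, List.sum_ofFn, Finset.sum_range]
  push_cast
  simp

theorem isBlock_ofFn_aux (x : ℕ → Bool) (n k : ℕ) :
    IsBlock (List.ofFn fun i : Fin n => x (k + i)) x := by
  refine ⟨k, ?_⟩
  apply List.ext_getElem <;> simp

theorem block_diff_aux (x : ℕ → Bool) (h : BalancedSeq x) (n j k : ℕ) :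
    |(∑ i ∈ Finset.range n, (if x (j + i) then (1 : ℝ) else 0))
      - ∑ i ∈ Finset.range n, (if x (k + i) then (1 : ℝ) else 0)| ≤ 1 := by
  have := h _ _ (isBlock_ofFn_aux x n j) (isBlock_ofFn_aux x n k) (by simp)
  rw [← digitSum_ofFn_aux, ← digitSum_ofFn_aux]
  exact_mod_cast this

theorem sum_blocks_aux (f : ℕ → ℝ) (n m : ℕ) :
    ∑ i ∈ Finset.range (m * n), f i
      = ∑ j ∈ Finset.range m, ∑ i ∈ Finset.range n, f (j * n + i) := by
  induction m with
  | zero => simp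
  | succ m ih => rw [Finset.sum_range_succ, ← ih, Nat.succ_mul, Finset.sum_range_add]

/-- If `α` is balanced with density `a`, then every contiguous block of `α` of length
`n ≥ 1` has average digit sum within `1/n` of `a`. -/
theorem statement14 (α : ℕ → Bool) (hbal : BalancedSeq α) (a : ℝ) (hden : HasDensity α a)
    (n k : ℕ) (hn : 1 ≤ n) :
    |a - (∑ i ∈ Finset.range n, (if α (k + i) then (1 : ℝ) else 0)) / n| ≤ 1 / n := by
  have hn0 : (0 : ℝ) < n := by exact_mod_cast hn
  have hsub : Tendsto (fun m : ℕ => m * n) atTop atTop :=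
    tendsto_id.atTop_mul_const' (by omega)
  have hlim := hden.comp hsub
  have hlim2 := (hlim.sub_const
    ((∑ i ∈ Finset.range n, (if α (k + i) then (1 : ℝ) else 0)) / n)).abs
  refine le_of_tendsto hlim2 ?_
  filter_upwards [eventually_ge_atTop 1] with m hm
  have hm0 : (0 : ℝ) < m := by exact_mod_cast hm
  simp only [Function.comp]
  rw [sum_blocks_aux (fun i => if α i then (1 : ℝ) else 0)]
  set S := ∑ i ∈ Finset.range n, (if α (k + i) then (1 : ℝ) else 0) with hS
  set T := ∑ j ∈ Finset.range m, ∑ i ∈ Finset.range n,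
    (if α (j * n + i) then (1 : ℝ) else 0) with hT
  have key : |T - m * S| ≤ m := by
    have e : T - m * S = ∑ j ∈ Finset.range m, ((∑ i ∈ Finset.range n,
        (if α (j * n + i) then (1 : ℝ) else 0)) - S) := by
      rw [Finset.sum_sub_distrib]; simp [hT]
    rw [e]
    refine (Finset.abs_sum_le_sum_abs _ _).trans ?_
    refine (Finset.sum_le_sum fun j _ => block_diff_aux α hbal n (j * n) k).trans ?_
    simp
  have e2 : T / ((m * n : ℕ) : ℝ) - S / n = (T - m * S) / (m * n) := by
    push_cast
    field_simp
  rw [e2, abs_div, abs_of_pos (mul_pos hm0 hn0), div_le_div_iff₀ (mul_pos hm0 hn0) hn0]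
  nlinarith
end

section
/- Let E ⊆ [0,1] be a compact set with E ∩ (0,1) ≠ ∅, and suppose there are reals λ_n ≥ 1, points u_n ∈ ℝ, and sequences x_n ∈ 2^ω such that the compact sets (λ_n K(x_n) + u_n) ∩ [0,1] converge to E in the Hausdorff metric. Then there exist x ∈ 2^ω, a real c > 0, natural numbers m_n, a strictly increasing sequence of indices k_n, a real v, and reals w_0 = 0, w_1, w_2, w_3 such that: (1) T^{m_n}(x_{k_n}) → x in 2^ω; (2) λ_{k_n} 2^{−m_n} → c; and (3) the set C = cK(x) + v satisfies C ⊆ E ⊆ ⋃_{i=0}^{3} (C + w_i). -/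
open Filter Set
open scoped ENNReal

/-- The compact set `K(x) ⊆ [0,1]` associated to `x ∈ 2^ω`: binary expansions
`∑ a_i 2^{-(i+1)}` where `a_i ∈ {0,1}` is forced to be `0` whenever `x i = 0`. -/
def KSet (x : ℕ → Bool) : Set ℝ :=
  {r | ∃ a : ℕ → Bool, (∀ i, x i = false → a i = false) ∧
    r = ∑' i : ℕ, (if a i then ((2 : ℝ) ^ (i + 1))⁻¹ else 0)}

/-- The `m`-fold iterate of the left shift on `2^ω`. -/
def shiftIter (m : ℕ) (x : ℕ → Bool) : ℕ → Bool := fun n => x (n + m)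

noncomputable def kval (a : ℕ → Bool) : ℝ :=
  ∑' i : ℕ, (if a i then ((2 : ℝ) ^ (i + 1))⁻¹ else 0)

noncomputable def kpre (m : ℕ) (a : ℕ → Bool) : ℝ :=
  ∑ i ∈ Finset.range m, (if a i then ((2 : ℝ) ^ (i + 1))⁻¹ else 0)

def kle (a x : ℕ → Bool) : Prop := ∀ i, x i = false → a i = false

lemma khasSum : HasSum (fun i : ℕ => ((2 : ℝ) ^ (i + 1))⁻¹) 1 := by
  have h := hasSum_geometric_two' (1 : ℝ)
  convert h using 2 with i
  rw [pow_succ]; field_simp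

lemma ksummable (a : ℕ → Bool) :
    Summable (fun i : ℕ => (if a i then ((2 : ℝ) ^ (i + 1))⁻¹ else 0)) := by
  refine Summable.of_nonneg_of_le (fun i => ?_) (fun i => ?_) khasSum.summable
  · split_ifs <;> positivity
  · split_ifs
    · exact le_rfl
    · positivity

lemma kval_nonneg (a : ℕ → Bool) : 0 ≤ kval a := by
  refine tsum_nonneg (fun i => ?_)
  split_ifs <;> positivity

lemma kval_le_one (a : ℕ → Bool) : kval a ≤ 1 := by
  rw [← khasSum.tsum_eq]
  refine Summable.tsum_le_tsum (fun i => ?_) (ksummable a) khasSum.summable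
  split_ifs
  · exact le_rfl
  · positivity

lemma kval_continuous : Continuous kval := by
  refine continuous_tsum (u := fun i : ℕ => ((2 : ℝ) ^ (i + 1))⁻¹) (fun i => ?_) khasSum.summable
    (fun i a => ?_)
  · exact (continuous_of_discreteTopology
      (f := fun b : Bool => (if b then ((2 : ℝ) ^ (i + 1))⁻¹ else 0))).comp (continuous_apply i)
  · split_ifs
    · rw [Real.norm_of_nonneg (by positivity)]
    · simp

lemma kval_split (m : ℕ) (a : ℕ → Bool) :
    kval a = kpre m a + ((2 : ℝ) ^ m)⁻¹ * kval (shiftIter m a) := by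
  unfold kval kpre
  rw [← (ksummable a).sum_add_tsum_nat_add m, ← tsum_mul_left]
  congr 1
  refine tsum_congr (fun i => ?_)
  change _ = ((2 : ℝ) ^ m)⁻¹ * (if a (i + m) then ((2 : ℝ) ^ (i + 1))⁻¹ else 0)
  split_ifs
  · rw [← mul_inv, ← pow_add]; congr 2; ring
  · simp

lemma kpre_succ (m : ℕ) (a : ℕ → Bool) :
    kpre (m + 1) a = kpre m a + (if a m then ((2 : ℝ) ^ (m + 1))⁻¹ else 0) := by
  simp [kpre, Finset.sum_range_succ]

lemma kpre_int (m : ℕ) (a : ℕ → Bool) : ∃ N : ℤ, kpre m a = N * ((2 : ℝ) ^ m)⁻¹ := by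
  induction m with
  | zero => exact ⟨0, by simp [kpre]⟩
  | succ m ih =>
    obtain ⟨N, hN⟩ := ih
    rw [kpre_succ, hN]
    have h2 : ((2 : ℝ) ^ m)⁻¹ = 2 * ((2 : ℝ) ^ (m + 1))⁻¹ := by
      rw [pow_succ]; field_simp
    split_ifs
    · exact ⟨2 * N + 1, by rw [h2]; push_cast; ring⟩
    · exact ⟨2 * N, by rw [h2]; push_cast; ring⟩

lemma kpre_sep (m : ℕ) (a a' : ℕ → Bool) (h : |kpre m a - kpre m a'| < ((2 : ℝ) ^ m)⁻¹) :
    kpre m a = kpre m a' := by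
  obtain ⟨N, hN⟩ := kpre_int m a
  obtain ⟨N', hN'⟩ := kpre_int m a'
  have hp : (0 : ℝ) < ((2 : ℝ) ^ m)⁻¹ := by positivity
  rw [hN, hN', ← sub_mul, abs_mul, abs_of_pos hp] at h
  have h1 : |(N : ℝ) - N'| < 1 := by
    by_contra hc
    push Not at hc
    nlinarith
  have h2 : |N - N'| < 1 := by exact_mod_cast h1
  have h3 : N = N' := by rw [Int.abs_lt_one_iff] at h2; omega
  rw [hN, hN', h3]

lemma kle_shift {a x : ℕ → Bool} (h : kle a x) (m : ℕ) : kle (shiftIter m a) (shiftIter m x) :=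
  fun i hi => h _ hi

lemma kglue (m : ℕ) {a b x : ℕ → Bool} (ha : kle a x) (hb : kle b (shiftIter m x)) :
    kpre m a + ((2 : ℝ) ^ m)⁻¹ * kval b ∈ KSet x := by
  set d : ℕ → Bool := fun i => if i < m then a i else b (i - m) with hd
  refine ⟨d, ?_, ?_⟩
  · intro i hi
    by_cases him : i < m
    · simp only [hd, him, if_true]; exact ha i hi
    · simp only [hd, him, if_false]
      apply hb
      simp only [shiftIter]
      rw [Nat.sub_add_cancel (by omega)]; exact hi
  · change _ = kval d
    rw [kval_split m d]
    congr 1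
    · unfold kpre
      refine Finset.sum_congr rfl (fun i hi => ?_)
      have := Finset.mem_range.1 hi
      simp [hd, this]
    · congr 2
      funext i
      simp [shiftIter, hd]

lemma ksub {S : Set ℝ} (h : ∀ p ∈ S, ∀ q ∈ S, p = q) (hb : ∀ p ∈ S, |p| ≤ 3) :
    ∃ p, |p| ≤ 3 ∧ ∀ a ∈ S, a = p := by
  rcases S.eq_empty_or_nonempty with h0 | ⟨p, hp⟩
  · exact ⟨0, by simp, by simp [h0]⟩
  · exact ⟨p, hb p hp, fun a ha => h a ha p hp⟩

lemma kfinite (x : ℕ → Bool) (l u ε r : ℝ) (hl : 1 ≤ l) (hε : 0 < ε) (hε1 : ε < 1)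
    (hr : r ∈ KSet x) (hr0 : ε ≤ l * r + u) (hr1 : l * r + u ≤ 1 - ε) :
    ∃ (m : ℕ) (A : Fin 4 → ℝ), ε / 2 ≤ l * ((2 : ℝ) ^ m)⁻¹ ∧ l * ((2 : ℝ) ^ m)⁻¹ ≤ 1 ∧
      (∀ i, |A i| ≤ 4) ∧
      (∀ b, kle b (shiftIter m x) → l * ((2 : ℝ) ^ m)⁻¹ * kval b + A 0 ∈
        ((fun r => l * r + u) '' KSet x) ∩ Set.Icc 0 1) ∧
      (∀ s ∈ ((fun r => l * r + u) '' KSet x) ∩ Set.Icc 0 1, ∃ i b, kle b (shiftIter m x) ∧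
        s = l * ((2 : ℝ) ^ m)⁻¹ * kval b + A i) := by
  classical
  have hlpos : 0 < l := by linarith
  have hLpos : ∀ j : ℕ, 0 < l * ((2 : ℝ) ^ j)⁻¹ := fun j => by positivity
  have hLs : ∀ j : ℕ, l * ((2 : ℝ) ^ (j + 1))⁻¹ = (l * ((2 : ℝ) ^ j)⁻¹) / 2 := fun j => by
    rw [pow_succ]; field_simp
  let Good : ℕ → Prop := fun m => l * ((2 : ℝ) ^ m)⁻¹ ≤ 1 ∧ ∃ a, kle a x ∧
    ∀ b, kle b (shiftIter m x) → l * (kpre m a + ((2 : ℝ) ^ m)⁻¹ * kval b) + u ∈ Set.Icc (0:ℝ) 1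
  have hex : ∃ m, ε / 2 ≤ l * ((2 : ℝ) ^ m)⁻¹ ∧ Good m := by
    have h0 : ∃ m : ℕ, l * ((2 : ℝ) ^ m)⁻¹ ≤ ε := by
      obtain ⟨m, hm⟩ := exists_pow_lt_of_lt_one (div_pos hε hlpos) (by norm_num : (1/2:ℝ) < 1)
      refine ⟨m, ?_⟩
      rw [one_div, inv_pow, lt_div_iff₀ hlpos] at hm
      linarith
    obtain ⟨m, hm, hmin⟩ : ∃ m : ℕ, l * ((2 : ℝ) ^ m)⁻¹ ≤ ε ∧
        ∀ j < m, ¬ l * ((2 : ℝ) ^ j)⁻¹ ≤ ε :=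
      ⟨Nat.find h0, Nat.find_spec h0, fun j hj => Nat.find_min h0 hj⟩
    refine ⟨m, ?_, hm.trans hε1.le, ?_⟩
    · cases m with
      | zero => simp; linarith
      | succ j =>
        have := hmin j (by omega)
        rw [hLs]; push Not at this; linarith
    · obtain ⟨a, ha, rfl⟩ := hr
      refine ⟨a, ha, fun b hb => ?_⟩
      change ε ≤ l * kval a + u at hr0
      change l * kval a + u ≤ 1 - ε at hr1
      rw [kval_split m a] at hr0 hr1
      have h1 := kval_nonneg b
      have h2 := kval_le_one b
      have h3 := kval_nonneg (shiftIter m a)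
      have h4 := kval_le_one (shiftIter m a)
      have h5 := hLpos m
      generalize kval (shiftIter m a) = t at *
      generalize kval b = t' at *
      constructor <;> nlinarith
  have hg : ∃ m, Good m := hex.imp fun m h => h.2
  obtain ⟨m, hm, hmin, hme⟩ : ∃ m, Good m ∧ (∀ j < m, ¬ Good j) ∧ ε / 2 ≤ l * ((2 : ℝ) ^ m)⁻¹ := by
    refine ⟨Nat.find hg, Nat.find_spec hg, fun j hj => Nat.find_min hg hj, ?_⟩
    obtain ⟨M, hM1, hM2⟩ := hex
    refine hM1.trans ?_
    have := Nat.find_min' hg hM2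
    gcongr
    norm_num
  obtain ⟨hm1, a, ha, hin⟩ := hm
  have hin' : ∀ b, kle b (shiftIter m x) → l * ((2 : ℝ) ^ m)⁻¹ * kval b + (l * kpre m a + u) ∈
        ((fun r => l * r + u) '' KSet x) ∩ Set.Icc 0 1 := by
    intro b hb
    have e : l * ((2 : ℝ) ^ m)⁻¹ * kval b + (l * kpre m a + u) =
      l * (kpre m a + ((2 : ℝ) ^ m)⁻¹ * kval b) + u := by ring
    rw [e]
    exact ⟨⟨_, kglue m ha hb, rfl⟩, hin b hb⟩
  suffices H : ∃ A : Fin 4 → ℝ, (∀ i, |A i| ≤ 4) ∧ ∀ a', kle a' x →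
      l * kval a' + u ∈ Set.Icc (0:ℝ) 1 → ∃ i, l * kpre m a' + u = A i by
    obtain ⟨A, hA, hcov⟩ := H
    have ha01 : l * kval a + u ∈ Set.Icc (0:ℝ) 1 := by
      have := hin _ (kle_shift ha m)
      rwa [← kval_split] at this
    obtain ⟨i0, hi0⟩ := hcov a ha ha01
    refine ⟨m, A ∘ Equiv.swap 0 i0, hme, hm1, fun i => hA _, ?_, ?_⟩
    · simp only [Function.comp, Equiv.swap_apply_left]
      rw [← hi0]; exact hin'
    · rintro s ⟨⟨r', ⟨a', ha', rfl⟩, rfl⟩, hs⟩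
      obtain ⟨i, hi⟩ := hcov a' ha' hs
      refine ⟨Equiv.swap 0 i0 i, shiftIter m a', kle_shift ha' m, ?_⟩
      simp only [Function.comp, Equiv.swap_apply_self]
      rw [← hi]
      change l * kval a' + u = _
      rw [kval_split m a']; ring
  cases m with
  | zero =>
    refine ⟨fun _ => u, fun i => ?_, fun a' _ _ => ⟨0, by simp [kpre]⟩⟩
    have h := hin (fun _ => false) (fun _ _ => rfl)
    have h0 : kval (fun _ => false) = 0 := by simp [kval]
    rw [h0] at h
    simp only [kpre, Finset.range_zero, Finset.sum_empty] at h
    have h1 := h.1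
    have h2 := h.2
    rw [abs_le]; constructor <;> linarith
  | succ j =>
    have hnG := hmin j (by omega)
    have hL2 : l * ((2 : ℝ) ^ j)⁻¹ ≤ 2 := by have := hLs j; linarith
    have hL0 := hLpos j
    have hsep : ∀ a a' : ℕ → Bool, |(l * kpre j a + u) - (l * kpre j a' + u)| <
        l * ((2 : ℝ) ^ j)⁻¹ → l * kpre j a + u = l * kpre j a' + u := by
      intro a a' h
      rw [show (l * kpre j a + u) - (l * kpre j a' + u) = l * (kpre j a - kpre j a') by ring,
        abs_mul, abs_of_pos hlpos] at h
      rw [kpre_sep j a a' (lt_of_mul_lt_mul_left h hlpos.le)]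
    let B : Set (ℕ → Bool) := {a' | kle a' x ∧ l * kval a' + u ∈ Set.Icc (0:ℝ) 1}
    have hBl : ∀ a' ∈ B, - (l * ((2 : ℝ) ^ j)⁻¹) ≤ l * kpre j a' + u ∧ l * kpre j a' + u ≤ 1 := by
      rintro a' ⟨_, h1, h2⟩
      rw [kval_split j a'] at h1 h2
      have h3 := kval_nonneg (shiftIter j a')
      have h4 := kval_le_one (shiftIter j a')
      generalize kval (shiftIter j a') = t at *
      constructor <;> nlinarith
    obtain ⟨p, hp, hpB⟩ := ksub (S := {σ | ∃ a' ∈ B, σ = l * kpre j a' + u ∧ σ < 0}) (by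
      rintro _ ⟨a1, h1, rfl, h1'⟩ _ ⟨a2, h2, rfl, h2'⟩
      have := hBl a1 h1
      have := hBl a2 h2
      apply hsep
      rw [abs_lt]; constructor <;> linarith) (by
      rintro _ ⟨a1, h1, rfl, h1'⟩
      have := hBl a1 h1
      rw [abs_le]; constructor <;> linarith)
    obtain ⟨q, hq, hqB⟩ := ksub (S := {σ | ∃ a' ∈ B, σ = l * kpre j a' + u ∧ 0 ≤ σ}) (by
      have key : ∀ a' ∈ B, 0 ≤ l * kpre j a' + u → 1 - l * ((2 : ℝ) ^ j)⁻¹ < l * kpre j a' + u := by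
        intro a' h1 h2
        by_contra hc
        push Not at hc
        refine hnG ⟨by linarith, a', h1.1, fun b hb => ?_⟩
        have h3 := kval_nonneg b
        have h4 := kval_le_one b
        generalize kval b = t at *
        constructor <;> nlinarith
      rintro _ ⟨a1, h1, rfl, h1'⟩ _ ⟨a2, h2, rfl, h2'⟩
      have := hBl a1 h1
      have := hBl a2 h2
      have := key a1 h1 h1'
      have := key a2 h2 h2'
      apply hsep
      rw [abs_lt]; constructor <;> linarith) (by
      rintro _ ⟨a1, h1, rfl, h1'⟩
      have := hBl a1 h1
      rw [abs_le]; constructor <;> linarith)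
    refine ⟨![p, p + l * ((2 : ℝ) ^ (j+1))⁻¹, q, q + l * ((2 : ℝ) ^ (j+1))⁻¹], ?_, ?_⟩
    · have := hLs j
      rw [abs_le] at hp hq
      intro i
      fin_cases i <;> simp only [Fin.isValue, Fin.zero_eta, Fin.mk_one, Fin.reduceFinMk,
        Matrix.cons_val] <;> rw [abs_le] <;> constructor <;> linarith
    · intro a' h1 h2
      rw [kpre_succ]
      rcases lt_or_ge (l * kpre j a' + u) 0 with h | h
      · have := hpB _ ⟨a', ⟨h1, h2⟩, rfl, h⟩
        split_ifs
        · exact ⟨1, by simp only [Fin.isValue, Matrix.cons_val]; rw [← this]; ring⟩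
        · exact ⟨0, by simp only [Fin.isValue, Matrix.cons_val]; rw [← this]; ring⟩
      · have := hqB _ ⟨a', ⟨h1, h2⟩, rfl, h⟩
        split_ifs
        · exact ⟨3, by simp only [Fin.isValue, Matrix.cons_val]; rw [← this]; ring⟩
        · exact ⟨2, by simp only [Fin.isValue, Matrix.cons_val]; rw [← this]; ring⟩

/-- If `(λ_n K(x_n) + u_n) ∩ [0,1]` converges in the Hausdorff metric to a compact set
`E ⊆ [0,1]` meeting `(0,1)`, then there are `y ∈ 2^ω`, `c > 0`, shifts `m_n`, indices
`k_n ↑ ∞`, and translations `v, w_0 = 0, w_1, w_2, w_3` so that `T^{m_n}(x_{k_n}) → y`,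
`λ_{k_n} 2^{-m_n} → c`, and `C = cK(y) + v` satisfies `C ⊆ E ⊆ ⋃_{i<4} (C + w_i)`. -/
theorem statement15 (E : Set ℝ) (hEc : IsCompact E) (hEsub : E ⊆ Set.Icc 0 1)
    (hEint : (E ∩ Set.Ioo 0 1).Nonempty)
    (lam : ℕ → ℝ) (hlam : ∀ n, 1 ≤ lam n) (u : ℕ → ℝ) (x : ℕ → ℕ → Bool)
    (hconv : Filter.Tendsto
      (fun n => EMetric.hausdorffEdist
        (((fun r => lam n * r + u n) '' KSet (x n)) ∩ Set.Icc 0 1) E)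
      Filter.atTop (nhds 0)) :
    ∃ (y : ℕ → Bool) (c : ℝ) (m : ℕ → ℕ) (k : ℕ → ℕ) (v : ℝ) (w : Fin 4 → ℝ),
      0 < c ∧ StrictMono k ∧ w 0 = 0 ∧
      Filter.Tendsto (fun n => shiftIter (m n) (x (k n))) Filter.atTop (nhds y) ∧
      Filter.Tendsto (fun n => lam (k n) * (2 : ℝ) ^ (-(m n : ℤ))) Filter.atTop (nhds c) ∧
      ((fun r => c * r + v) '' KSet y) ⊆ E ∧
      E ⊆ ⋃ i : Fin 4, (fun r => c * r + v + w i) '' KSet y := by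
  change Tendsto (fun n => Metric.hausdorffEDist (((fun r => lam n * r + u n) '' KSet (x n)) ∩ Set.Icc 0 1) E) atTop (nhds 0) at hconv
  obtain ⟨p, hpE, hp0, hp1⟩ := hEint
  set S : ℕ → Set ℝ := fun n => ((fun r => lam n * r + u n) '' KSet (x n)) ∩ Set.Icc 0 1 with hS
  set ε : ℝ := min p (1 - p) / 2 with hεd
  have hmin0 : 0 < min p (1 - p) := lt_min hp0 (by linarith)
  have hε : 0 < ε := by positivity
  have hεp : 2 * ε ≤ p := by have := min_le_left p (1 - p); linarith
  have hεq : 2 * ε ≤ 1 - p := by have := min_le_right p (1 - p); linarith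
  have hev : ∀ᶠ n in atTop, Metric.hausdorffEDist (S n) E < ENNReal.ofReal ε :=
    hconv.eventually (gt_mem_nhds (by simpa using hε))
  obtain ⟨N, hN⟩ := eventually_atTop.1 hev
  have hfin : ∀ n, ∃ (m : ℕ) (A : Fin 4 → ℝ), ε / 2 ≤ lam (n + N) * ((2 : ℝ) ^ m)⁻¹ ∧
      lam (n + N) * ((2 : ℝ) ^ m)⁻¹ ≤ 1 ∧ (∀ i, |A i| ≤ 4) ∧
      (∀ b, kle b (shiftIter m (x (n + N))) →
        lam (n + N) * ((2 : ℝ) ^ m)⁻¹ * kval b + A 0 ∈ S (n + N)) ∧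
      (∀ s ∈ S (n + N), ∃ i b, kle b (shiftIter m (x (n + N))) ∧
        s = lam (n + N) * ((2 : ℝ) ^ m)⁻¹ * kval b + A i) := by
    intro n
    have h1 := hN (n + N) (by omega)
    rw [Metric.hausdorffEDist_comm] at h1
    obtain ⟨s, hs, hd⟩ := Metric.exists_edist_lt_of_hausdorffEDist_lt hpE h1
    rw [edist_lt_ofReal, Real.dist_eq, abs_lt] at hd
    obtain ⟨⟨r, hr, rfl⟩, hs2⟩ := hs
    refine kfinite (x (n + N)) (lam (n + N)) (u (n + N)) ε r (hlam _) hε (by linarith) hr ?_ ?_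
    · simp only at hd; linarith
    · simp only at hd; linarith
  choose m A hc1 hc2 hA hsub hcov using hfin
  let z : ℕ → (ℕ → Bool) × ℝ × (Fin 4 → ℝ) := fun n =>
    (shiftIter (m n) (x (n + N)), lam (n + N) * ((2 : ℝ) ^ (m n))⁻¹, A n)
  have hcomp : IsCompact ((Set.univ : Set (ℕ → Bool)) ×ˢ (Set.Icc (ε/2) 1) ×ˢ
      (Set.Icc (fun _ => -4) (fun _ => 4) : Set (Fin 4 → ℝ))) :=
    isCompact_univ.prod (isCompact_Icc.prod isCompact_Icc)
  obtain ⟨⟨y, c, α⟩, hmem, φ, hφ, hlim⟩ := hcomp.tendsto_subseq (x := z) (fun n =>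
    ⟨Set.mem_univ _, ⟨hc1 n, hc2 n⟩, ⟨fun i => (abs_le.1 (hA n i)).1, fun i => (abs_le.1 (hA n i)).2⟩⟩)
  have hly : Tendsto (fun n => shiftIter (m (φ n)) (x (φ n + N))) atTop (nhds y) :=
    (continuous_fst.tendsto _).comp hlim
  have hlc : Tendsto (fun n => lam (φ n + N) * ((2 : ℝ) ^ (m (φ n)))⁻¹) atTop (nhds c) :=
    ((continuous_fst.comp continuous_snd).tendsto _).comp hlim
  have hlα : Tendsto (fun n => A (φ n)) atTop (nhds α) :=
    ((continuous_snd.comp continuous_snd).tendsto _).comp hlim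
  have hlαi : ∀ i, Tendsto (fun n => A (φ n) i) atTop (nhds (α i)) := fun i =>
    ((continuous_apply i).tendsto _).comp hlα
  have hc : 0 < c := by
    have := hmem.2.1.1
    simp only at this
    linarith
  have hk : StrictMono (fun n => φ n + N) := fun a b h => by
    have := hφ h
    simp only; omega
  have hhd : Tendsto (fun n => Metric.hausdorffEDist (S (φ n + N)) E) atTop (nhds 0) :=
    hconv.comp hk.tendsto_atTop
  have hhd2 : Tendsto (fun n : ℕ => Metric.hausdorffEDist (S (φ n + N)) E +
      ((n : ℝ≥0∞) + 1)⁻¹) atTop (nhds 0) := by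
    have h1 : Tendsto (fun n : ℕ => ((n : ℝ≥0∞) + 1)⁻¹) atTop (nhds 0) := by
      have := (tendsto_add_atTop_iff_nat 1).2 ENNReal.tendsto_inv_nat_nhds_zero
      simpa using this
    simpa using hhd.add h1
  have hlt : ∀ n : ℕ, Metric.hausdorffEDist (S (φ n + N)) E <
      Metric.hausdorffEDist (S (φ n + N)) E + ((n : ℝ≥0∞) + 1)⁻¹ := by
    intro n
    refine ENNReal.lt_add_right (ne_top_of_lt (hN (φ n + N) (by omega))) ?_
    simp
  have hcoord : ∀ (f : ℕ → ℕ → Bool) (g : ℕ → Bool), Tendsto f atTop (nhds g) →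
      ∀ i, ∀ᶠ n in atTop, f n i = g i := by
    intro f g h i
    have h1 : Tendsto (fun n => f n i) atTop (nhds (g i)) :=
      ((continuous_apply i).tendsto _).comp h
    rw [nhds_discrete, tendsto_pure] at h1
    exact h1
  refine ⟨y, c, fun n => m (φ n), fun n => φ n + N, α 0, fun i => α i - α 0, hc, hk, by simp, hly,
    ?_, ?_, ?_⟩
  · simpa [zpow_neg] using hlc
  · rintro _ ⟨r, ⟨b, hb, rfl⟩, rfl⟩
    change c * kval b + α 0 ∈ E
    let bn : ℕ → ℕ → Bool := fun n i => b i && shiftIter (m (φ n)) (x (φ n + N)) i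
    have hbn : Tendsto bn atTop (nhds b) := by
      rw [tendsto_pi_nhds]
      intro i
      rw [nhds_discrete, tendsto_pure]
      filter_upwards [hcoord _ _ hly i] with n hn
      simp only [bn, hn]
      have := hb i
      cases hy : y i <;> simp_all
    have hin : ∀ n, lam (φ n + N) * ((2 : ℝ) ^ (m (φ n)))⁻¹ * kval (bn n) + A (φ n) 0 ∈
        S (φ n + N) := fun n => hsub (φ n) _ (fun i hi => by simp [bn, hi])
    have hl : Tendsto (fun n => lam (φ n + N) * ((2 : ℝ) ^ (m (φ n)))⁻¹ * kval (bn n) + A (φ n) 0)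
        atTop (nhds (c * kval b + α 0)) :=
      (hlc.mul ((kval_continuous.tendsto _).comp hbn)).add (hlαi 0)
    have hex : ∀ n, ∃ e ∈ E, _ := fun n =>
      Metric.exists_edist_lt_of_hausdorffEDist_lt (hin n) (hlt n)
    choose e heE hed using hex
    have hde : Tendsto (fun n => edist (lam (φ n + N) * ((2 : ℝ) ^ (m (φ n)))⁻¹ * kval (bn n)
        + A (φ n) 0) (e n)) atTop (nhds 0) :=
      tendsto_of_tendsto_of_tendsto_of_le_of_le tendsto_const_nhds hhd2 (fun n => zero_le)
        (fun n => (hed n).le)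
    have hle : Tendsto e atTop (nhds (c * kval b + α 0)) := by
      rw [tendsto_iff_edist_tendsto_0] at hl ⊢
      have := hde.add hl
      rw [add_zero] at this
      refine tendsto_of_tendsto_of_tendsto_of_le_of_le tendsto_const_nhds this (fun n => zero_le)
        (fun n => ?_)
      have := edist_triangle_left (e n) (c * kval b + α 0) (lam (φ n + N) *
        ((2 : ℝ) ^ (m (φ n)))⁻¹ * kval (bn n) + A (φ n) 0)
      exact this
    exact hEc.isClosed.mem_of_tendsto hle (Eventually.of_forall heE)
  · intro e he
    have hex : ∀ n, ∃ s ∈ S (φ n + N), _ := fun n =>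
      Metric.exists_edist_lt_of_hausdorffEDist_lt he
        (by rw [Metric.hausdorffEDist_comm]; exact hlt n)
    choose s hsS hsd using hex
    have hls : Tendsto s atTop (nhds e) := by
      rw [tendsto_iff_edist_tendsto_0]
      refine tendsto_of_tendsto_of_tendsto_of_le_of_le tendsto_const_nhds hhd2 (fun n => zero_le)
        (fun n => ?_)
      simp only
      rw [edist_comm]
      exact (hsd n).le
    choose i b hb hsb using fun n => hcov (φ n) (s n) (hsS n)
    obtain ⟨⟨i0, b0⟩, -, ψ, hψ, hlim2⟩ := (isCompact_univ (X := Fin 4 × (ℕ → Bool))).tendsto_subseq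
      (x := fun n => (i n, b n)) (fun n => Set.mem_univ _)
    have hi0 : ∀ᶠ n in atTop, i (ψ n) = i0 := by
      have h1 : Tendsto (fun n => i (ψ n)) atTop (nhds i0) := (continuous_fst.tendsto _).comp hlim2
      rw [nhds_discrete, tendsto_pure] at h1
      exact h1
    have hlb : Tendsto (fun n => b (ψ n)) atTop (nhds b0) := (continuous_snd.tendsto _).comp hlim2
    have hl : Tendsto (fun n => lam (φ (ψ n) + N) * ((2 : ℝ) ^ (m (φ (ψ n))))⁻¹ * kval (b (ψ n)) +
        A (φ (ψ n)) i0) atTop (nhds (c * kval b0 + α i0)) :=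
      ((hlc.comp hψ.tendsto_atTop).mul ((kval_continuous.tendsto _).comp hlb)).add
        ((hlαi i0).comp hψ.tendsto_atTop)
    have heq : e = c * kval b0 + α i0 := by
      refine tendsto_nhds_unique (hls.comp hψ.tendsto_atTop) (hl.congr' ?_)
      filter_upwards [hi0] with n hn
      simp only [Function.comp]
      rw [hsb (ψ n), hn]
    rw [Set.mem_iUnion]
    refine ⟨i0, kval b0, ⟨b0, ?_, rfl⟩, ?_⟩
    · intro j hj
      obtain ⟨n, h1, h2⟩ := ((hcoord _ _ hlb j).and
        (hcoord _ _ (hly.comp hψ.tendsto_atTop) j)).exists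
      rw [← h1]
      apply hb
      simp only [Function.comp] at h2
      rw [h2]; exact hj
    · simp only; rw [heq]; ring
end
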